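/- arXiv:1505.06098 — 2 statements merged into one kernel-verified Lean document; each statement's English description precedes it below -/
import Mathlib

section
/- The total number of occupied corners over all tree-like tableaux of size n equals n!. -/
open Polynomial

/-- A tree-like tableau: a Young diagram together with a set of pointed cells,
such that the top-left cell is pointed (the root point), every non-root point
has a point above it in its column or to its left in its row but not both,
and no row or column of the diagram is empty of points. Cells are indexed by
`(row, column)` with the top-left cell `(0,0)`. -/
structure TreeLikeTableau where
  shape : YoungDiagram
  points : Finset (ℕ × ℕ)
  points_subset : points ⊆ shape.cells
  root_mem : (0, 0) ∈ points
  point_cond : ∀ p ∈ points, p ≠ (0, 0) →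
    Xor' (∃ r < p.1, (r, p.2) ∈ points) (∃ c < p.2, (p.1, c) ∈ points)
  no_empty_row : ∀ i j : ℕ, (i, j) ∈ shape.cells → ∃ c, (i, c) ∈ points
  no_empty_col : ∀ i j : ℕ, (i, j) ∈ shape.cells → ∃ r, (r, j) ∈ points

namespace TreeLikeTableau

/-- The size of a tree-like tableau is its number of points. -/
def size (T : TreeLikeTableau) : ℕ := T.points.card

/-- The occupied corners of a tree-like tableau: pointed cells whose bottom
and right edges lie on the Southeast border of the diagram. -/
def occCorners (T : TreeLikeTableau) : Finset (ℕ × ℕ) :=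
  T.points.filter (fun p => (p.1 + 1, p.2) ∉ T.shape.cells ∧ (p.1, p.2 + 1) ∉ T.shape.cells)

/-- The number of occupied corners. -/
def oc (T : TreeLikeTableau) : ℕ := T.occCorners.card

end TreeLikeTableau

namespace TreeLikeTableau

lemma eq_of_mem_iff {T T' : TreeLikeTableau}
    (hs : ∀ i j, (i, j) ∈ T.shape.cells ↔ (i, j) ∈ T'.shape.cells)
    (hp : ∀ i j, (i, j) ∈ T.points ↔ (i, j) ∈ T'.points) : T = T' := by
  have h1 : T.shape = T'.shape := YoungDiagram.ext (Finset.ext fun p => hs p.1 p.2)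
  have h2 : T.points = T'.points := Finset.ext fun p => hp p.1 p.2
  cases T
  cases T'
  simp_all

lemma mem_shape_of_le (T : TreeLikeTableau) {i j i' j' : ℕ} (hi : i' ≤ i) (hj : j' ≤ j)
    (h : (i, j) ∈ T.shape.cells) : (i', j') ∈ T.shape.cells :=
  T.shape.up_left_mem hi hj h

lemma mem_shape_row_zero (T : TreeLikeTableau) (j : ℕ) :
    (0, j) ∈ T.shape.cells ↔ j < T.shape.rowLen 0 :=
  YoungDiagram.mem_iff_lt_rowLen

/-- The columns of the points in the first row. -/
def top (T : TreeLikeTableau) : Finset ℕ :=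
  (T.points.filter fun p => p.1 = 0).image Prod.snd

@[simp]
lemma mem_top (T : TreeLikeTableau) (j : ℕ) : j ∈ T.top ↔ (0, j) ∈ T.points := by
  simp [top]

/-- The columns of the occupied corners in the first row. -/
def tip (T : TreeLikeTableau) : Finset ℕ :=
  T.top.filter fun j => (1, j) ∉ T.shape.cells ∧ (0, j + 1) ∉ T.shape.cells

@[simp]
lemma mem_tip (T : TreeLikeTableau) (j : ℕ) :
    j ∈ T.tip ↔ (0, j) ∈ T.points ∧ (1, j) ∉ T.shape.cells ∧ (0, j + 1) ∉ T.shape.cells := by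
  simp [tip]

@[simp]
lemma mem_occCorners (T : TreeLikeTableau) (i j : ℕ) :
    (i, j) ∈ T.occCorners ↔
      (i, j) ∈ T.points ∧ (i + 1, j) ∉ T.shape.cells ∧ (i, j + 1) ∉ T.shape.cells := by
  simp [occCorners]

lemma tip_subset_top (T : TreeLikeTableau) : T.tip ⊆ T.top :=
  Finset.filter_subset _ _

/-- The tableau with a single cell. -/
def single : TreeLikeTableau where
  shape :=
    { cells := {(0, 0)}
      isLowerSet := by
        rintro ⟨a, b⟩ ⟨c, d⟩ ⟨h1, h2⟩ h
        simp_all }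
  points := {(0, 0)}
  points_subset := subset_rfl
  root_mem := by simp
  point_cond := by simp
  no_empty_row := by simp
  no_empty_col := by simp

lemma eq_single {T : TreeLikeTableau} (h : T.size = 1) : T = single := by
  obtain ⟨p, hp⟩ := Finset.card_eq_one.mp h
  have h0 := T.root_mem
  rw [hp, Finset.mem_singleton] at h0
  subst h0
  refine eq_of_mem_iff (fun i j => ?_) fun i j => by rw [hp]; rfl
  constructor
  · intro hij
    obtain ⟨c, hc⟩ := T.no_empty_row i j hij
    obtain ⟨r, hr⟩ := T.no_empty_col i j hij
    simp_all [single]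
  · intro hij
    have : (i, j) = (0, 0) := by simpa [single] using hij
    rw [this]
    exact T.points_subset T.root_mem

/-- Append to the first row a new column consisting of one pointed cell. -/
def addCol (T : TreeLikeTableau) : TreeLikeTableau where
  shape :=
    { cells := insert (0, T.shape.rowLen 0) T.shape.cells
      isLowerSet := by
        rintro ⟨a, b⟩ ⟨c, d⟩ ⟨h1, h2⟩ h
        simp only [Finset.coe_insert, Set.mem_insert_iff, Finset.mem_coe, Prod.mk.injEq] at h ⊢
        simp only at h1 h2
        rcases h with ⟨rfl, rfl⟩ | h
        · obtain rfl : c = 0 := by omega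
          rw [mem_shape_row_zero]
          omega
        · exact Or.inr (T.mem_shape_of_le h1 h2 h) }
  points := insert (0, T.shape.rowLen 0) T.points
  points_subset := Finset.insert_subset_insert _ T.points_subset
  root_mem := Finset.mem_insert_of_mem T.root_mem
  point_cond := by
    have hcol : ∀ i j, (i, j) ∈ T.points → j < T.shape.rowLen 0 := fun i j h =>
      (T.mem_shape_row_zero j).1 (T.mem_shape_of_le (Nat.zero_le _) le_rfl (T.points_subset h))
    rintro ⟨i, j⟩ hp h0
    simp only [Finset.mem_insert, Prod.mk.injEq] at hp ⊢
    rcases hp with ⟨rfl, rfl⟩ | hp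
    · refine Or.inr ⟨⟨0, ?_, Or.inr T.root_mem⟩, by simp⟩
      have := hcol 0 0 T.root_mem
      omega
    · have hj := hcol i j hp
      have := T.point_cond _ hp h0
      have e1 : ∀ r, ((r = 0 ∧ j = T.shape.rowLen 0) ∨ (r, j) ∈ T.points) ↔ (r, j) ∈ T.points :=
        fun r => ⟨fun h => h.resolve_left fun h => by omega, Or.inr⟩
      have e2 : ∀ c, (c < j ∧ ((i = 0 ∧ c = T.shape.rowLen 0) ∨ (i, c) ∈ T.points)) ↔
          (c < j ∧ (i, c) ∈ T.points) :=
        fun c => ⟨fun h => ⟨h.1, h.2.resolve_left fun h' => by omega⟩, fun h => ⟨h.1, Or.inr h.2⟩⟩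
      simpa only [e1, e2] using this
  no_empty_row := by
    intro i j h
    simp only [Finset.mem_insert, Prod.mk.injEq] at h ⊢
    rcases h with ⟨rfl, rfl⟩ | h
    · exact ⟨_, Or.inl ⟨rfl, rfl⟩⟩
    · obtain ⟨c, hc⟩ := T.no_empty_row i j h
      exact ⟨c, Or.inr hc⟩
  no_empty_col := by
    intro i j h
    simp only [Finset.mem_insert, Prod.mk.injEq] at h ⊢
    rcases h with ⟨rfl, rfl⟩ | h
    · exact ⟨_, Or.inl ⟨rfl, rfl⟩⟩
    · obtain ⟨c, hc⟩ := T.no_empty_col i j h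
      exact ⟨c, Or.inr hc⟩

@[simp]
lemma mem_addCol_shape (T : TreeLikeTableau) (i j : ℕ) :
    (i, j) ∈ T.addCol.shape.cells ↔ (i = 0 ∧ j = T.shape.rowLen 0) ∨ (i, j) ∈ T.shape.cells := by
  simp [addCol]

@[simp]
lemma mem_addCol_points (T : TreeLikeTableau) (i j : ℕ) :
    (i, j) ∈ T.addCol.points ↔ (i = 0 ∧ j = T.shape.rowLen 0) ∨ (i, j) ∈ T.points := by
  simp [addCol]

lemma col_lt_of_mem_shape (T : TreeLikeTableau) {i j : ℕ} (h : (i, j) ∈ T.shape.cells) :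
    j < T.shape.rowLen 0 :=
  (T.mem_shape_row_zero j).1 (T.mem_shape_of_le (Nat.zero_le _) le_rfl h)

lemma not_mem_shape_rowLen (T : TreeLikeTableau) (i : ℕ) :
    (i, T.shape.rowLen 0) ∉ T.shape.cells :=
  fun h => lt_irrefl _ (T.col_lt_of_mem_shape h)

lemma not_mem_points_rowLen (T : TreeLikeTableau) (i : ℕ) :
    (i, T.shape.rowLen 0) ∉ T.points :=
  fun h => T.not_mem_shape_rowLen i (T.points_subset h)

lemma size_addCol (T : TreeLikeTableau) : T.addCol.size = T.size + 1 :=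
  Finset.card_insert_of_notMem (T.not_mem_points_rowLen 0)

lemma card_top_addCol (T : TreeLikeTableau) : T.addCol.top.card = T.top.card + 1 := by
  have : T.addCol.top = insert (T.shape.rowLen 0) T.top := by
    ext j
    simp
  rw [this, Finset.card_insert_of_notMem]
  simpa using T.not_mem_points_rowLen 0

lemma tip_addCol (T : TreeLikeTableau) : T.addCol.tip = {T.shape.rowLen 0} := by
  ext j
  simp only [mem_tip, mem_addCol_points, mem_addCol_shape, Finset.mem_singleton, true_and,
    one_ne_zero, false_and, false_or]
  constructor
  · rintro ⟨h | h, h1, h2⟩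
    · exact h
    · have := T.col_lt_of_mem_shape (T.points_subset h)
      rw [T.mem_shape_row_zero] at h2
      omega
  · rintro rfl
    refine ⟨Or.inl rfl, T.not_mem_shape_rowLen 1, ?_⟩
    rw [T.mem_shape_row_zero]
    omega

lemma occCorners_row_zero (T : TreeLikeTableau) (A : Finset ℕ) :
    (T.occCorners.filter fun p => p.1 = 0 ∧ p.2 ∉ A).card = (T.tip \ A).card := by
  have : (T.occCorners.filter fun p => p.1 = 0 ∧ p.2 ∉ A) =
      (T.tip \ A).image fun j => (0, j) := by
    ext ⟨i, j⟩
    simp only [Finset.mem_filter, mem_occCorners, Finset.mem_image, Finset.mem_sdiff, mem_tip,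
      Prod.mk.injEq]
    constructor
    · rintro ⟨h, rfl, hA⟩
      exact ⟨j, ⟨h, hA⟩, rfl, rfl⟩
    · rintro ⟨j, ⟨h, hA⟩, rfl, rfl⟩
      exact ⟨h, rfl, hA⟩
  rw [this, Finset.card_image_of_injective _ (Prod.mk_right_injective 0)]

lemma oc_addCol (T : TreeLikeTableau) : T.addCol.oc + T.tip.card = T.oc + 1 := by
  have h : T.addCol.occCorners = insert (0, T.shape.rowLen 0)
      (T.occCorners.filter fun p => ¬ (p.1 = 0 ∧ p.2 ∉ (∅ : Finset ℕ))) := by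
    ext ⟨i, j⟩
    simp only [mem_occCorners, mem_addCol_points, mem_addCol_shape, Finset.mem_insert,
      Finset.mem_filter, Prod.mk.injEq, Finset.notMem_empty, not_false_eq_true, and_true]
    constructor
    · rintro ⟨h | h, h1, h2⟩
      · exact Or.inl h
      · push Not at h1 h2
        refine Or.inr ⟨⟨h, h1.2, h2.2⟩, ?_⟩
        rintro rfl
        have h3 := T.col_lt_of_mem_shape (T.points_subset h)
        have h4 := h2.2
        rw [mem_shape_row_zero] at h4
        have := h2.1 rfl
        omega
    · rintro (⟨rfl, rfl⟩ | ⟨⟨h, h1, h2⟩, h3⟩)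
      · refine ⟨Or.inl ⟨rfl, rfl⟩, ?_, ?_⟩
        · simpa using T.not_mem_shape_rowLen 1
        · rw [T.mem_shape_row_zero]
          omega
      · exact ⟨Or.inr h, by simp [h1], by simp [h2, h3]⟩
  have h2 := T.occCorners_row_zero ∅
  rw [Finset.sdiff_empty] at h2
  rw [oc, h, Finset.card_insert_of_notMem, oc, ← h2,
    ← Finset.card_filter_add_card_filter_not (s := T.occCorners)
      (fun p => p.1 = 0 ∧ p.2 ∉ (∅ : Finset ℕ))]
  · ring
  · simp

lemma addCol_injective : Function.Injective addCol := by
  intro T T' h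
  have hs : ∀ i j, (i, j) ∈ T.addCol.shape.cells ↔ (i, j) ∈ T'.addCol.shape.cells := by simp [h]
  have hp : ∀ i j, (i, j) ∈ T.addCol.points ↔ (i, j) ∈ T'.addCol.points := by simp [h]
  simp only [mem_addCol_shape, mem_addCol_points] at hs hp
  have hc : T.shape.rowLen 0 = T'.shape.rowLen 0 := by
    have := T.tip_addCol
    rw [h, tip_addCol] at this
    simpa using this.symm
  rw [← hc] at hs hp
  refine eq_of_mem_iff (fun i j => ?_) fun i j => ?_
  · have h1 := T.not_mem_shape_rowLen i
    have h2 := T'.not_mem_shape_rowLen i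
    have h3 := hs i j
    rw [← hc] at h2
    by_cases hj : j = T.shape.rowLen 0
    · subst hj; tauto
    · tauto
  · have h1 := T.not_mem_points_rowLen i
    have h2 := T'.not_mem_points_rowLen i
    have h3 := hp i j
    rw [← hc] at h2
    by_cases hj : j = T.shape.rowLen 0
    · subst hj; tauto
    · tauto

/-- A tableau with at least two points and an occupied corner in the first row arises by appending
a column. -/
lemma exists_addCol (T : TreeLikeTableau) (hT : T.size ≠ 1) {j₀ : ℕ}
    (h0 : (0, j₀) ∈ T.shape.cells) (h1 : (1, j₀) ∉ T.shape.cells) :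
    ∃ T' : TreeLikeTableau, T'.addCol = T := by
  obtain ⟨c, hc⟩ : ∃ c, T.shape.rowLen 0 = c + 1 :=
    Nat.exists_eq_succ_of_ne_zero (by have := T.col_lt_of_mem_shape h0; omega)
  have hrow : ∀ j, (0, j) ∈ T.shape.cells ↔ j < c + 1 := fun j => by
    rw [mem_shape_row_zero, hc]
  have hcol : ∀ i, (i, c) ∈ T.shape.cells → i = 0 := fun i hi => by
    by_contra hne
    refine h1 (T.mem_shape_of_le (by omega) ?_ hi)
    have := (hrow j₀).1 h0
    omega
  have hcp : (0, c) ∈ T.points := by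
    obtain ⟨r, hr⟩ := T.no_empty_col 0 c ((hrow c).2 (by omega))
    rwa [hcol r (T.points_subset hr)] at hr
  have hc0 : c ≠ 0 := by
    rintro rfl
    refine hT (Finset.card_eq_one.2 ⟨(0, 0), Finset.eq_singleton_iff_unique_mem.2
      ⟨T.root_mem, ?_⟩⟩)
    rintro ⟨i, j⟩ hp
    have hj := T.col_lt_of_mem_shape (T.points_subset hp)
    obtain rfl : j = 0 := by omega
    rw [hcol i (T.points_subset hp)]
  let T' : TreeLikeTableau :=
    { shape :=
        { cells := T.shape.cells.erase (0, c)
          isLowerSet := by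
            rintro ⟨a, b⟩ ⟨a', b'⟩ ⟨ha, hb⟩ h
            simp only [Finset.coe_erase, Set.mem_sdiff, Finset.mem_coe, Set.mem_singleton_iff,
              Prod.mk.injEq] at h ⊢
            simp only at ha hb
            refine ⟨T.mem_shape_of_le ha hb h.1, ?_⟩
            rintro ⟨rfl, rfl⟩
            have := T.col_lt_of_mem_shape h.1
            obtain rfl : b = b' := by omega
            exact h.2 ⟨hcol a h.1, rfl⟩ }
      points := T.points.erase (0, c)
      points_subset := Finset.erase_subset_erase _ T.points_subset
      root_mem := by simp [T.root_mem, hc0.symm]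
      point_cond := by
        rintro ⟨i, j⟩ hp h
        simp only [Finset.mem_erase, ne_eq, Prod.mk.injEq] at hp ⊢
        have hj := T.col_lt_of_mem_shape (T.points_subset hp.2)
        have hcl := hcol i
        have hin := T.points_subset hp.2
        have e1 : ∀ r, (¬ (r = 0 ∧ j = c) ∧ (r, j) ∈ T.points) ↔ (r, j) ∈ T.points :=
          fun r => ⟨And.right, fun h => ⟨fun ⟨_, e⟩ => by subst e; exact hp.1 ⟨hcl hin, rfl⟩, h⟩⟩
        have e2 : ∀ k, (k < j ∧ ¬ (i = 0 ∧ k = c) ∧ (i, k) ∈ T.points) ↔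
            (k < j ∧ (i, k) ∈ T.points) :=
          fun k => ⟨fun h => ⟨h.1, h.2.2⟩, fun h => ⟨h.1, fun _ => by omega, h.2⟩⟩
        simpa only [e1, e2] using T.point_cond _ hp.2 h
      no_empty_row := by
        intro i j h
        simp only [Finset.mem_erase, ne_eq, Prod.mk.injEq] at h ⊢
        by_cases hi : i = 0
        · subst hi
          exact ⟨0, by omega, T.root_mem⟩
        · obtain ⟨k, hk⟩ := T.no_empty_row i j h.2
          exact ⟨k, by omega, hk⟩
      no_empty_col := by
        intro i j h
        simp only [Finset.mem_erase, ne_eq, Prod.mk.injEq] at h ⊢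
        obtain ⟨k, hk⟩ := T.no_empty_col i j h.2
        refine ⟨k, ?_, hk⟩
        rintro ⟨rfl, rfl⟩
        exact h.1 ⟨hcol i h.2, rfl⟩ }
  have hlen : T'.shape.rowLen 0 = c := by
    have h2 : ∀ j, j < T'.shape.rowLen 0 ↔ j < c := fun j => by
      rw [← mem_shape_row_zero]
      simp only [T', Finset.mem_erase, ne_eq, Prod.mk.injEq, true_and, hrow]
      omega
    have h3 := h2 c
    have h4 := h2 (T'.shape.rowLen 0)
    omega
  refine ⟨T', eq_of_mem_iff (fun i j => ?_) fun i j => ?_⟩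
  · rw [mem_addCol_shape, hlen]
    simp only [T', Finset.mem_erase, ne_eq, Prod.mk.injEq]
    have := (hrow c).2 (by omega)
    by_cases h : i = 0 ∧ j = c
    · simp [h, this]
    · simp [h]
  · rw [mem_addCol_points, hlen]
    simp only [T', Finset.mem_erase, ne_eq, Prod.mk.injEq]
    by_cases h : i = 0 ∧ j = c
    · simp [h, hcp]
    · simp [h]

/-- The map fixing the cells of the first row outside the columns `A` and moving every other cell
one row down. -/
def shift (A : Finset ℕ) (p : ℕ × ℕ) : ℕ × ℕ :=
  if p.1 = 0 ∧ p.2 ∉ A then p else (p.1 + 1, p.2)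

lemma shift_injective (A : Finset ℕ) : Function.Injective (shift A) := by
  rintro ⟨a, b⟩ ⟨c, d⟩ h
  unfold shift at h
  split_ifs at h with h1 h2 h2 <;> simp_all

/-- The cells of a tableau after duplicating its first row. -/
def splitCells (T : TreeLikeTableau) : Finset (ℕ × ℕ) :=
  T.shape.cells ∪ T.shape.cells.image fun p => (p.1 + 1, p.2)

lemma mem_splitCells (T : TreeLikeTableau) (i j : ℕ) :
    (i, j) ∈ T.splitCells ↔ (i - 1, j) ∈ T.shape.cells := by
  simp only [splitCells, Finset.mem_union, Finset.mem_image, Prod.mk.injEq, Prod.exists]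
  constructor
  · rintro (h | ⟨a, b, h, rfl, rfl⟩)
    · exact T.mem_shape_of_le (Nat.sub_le _ _) le_rfl h
    · exact h
  · intro h
    cases i with
    | zero => exact Or.inl h
    | succ i => exact Or.inr ⟨i, j, h, rfl, rfl⟩

/-- The points of a tableau after moving the points of the first row in the columns `A` to a new
second row, the leftmost of them being also kept in the first row. -/
def splitPoints (T : TreeLikeTableau) (A : Finset ℕ) (hA : A.Nonempty) : Finset (ℕ × ℕ) :=
  insert (0, A.min' hA) (T.points.image (shift A))

lemma zero_mem_splitPoints (T : TreeLikeTableau) (A : Finset ℕ) (hA : A.Nonempty) (j : ℕ) :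
    (0, j) ∈ T.splitPoints A hA ↔ j = A.min' hA ∨ ((0, j) ∈ T.points ∧ j ∉ A) := by
  simp only [splitPoints, Finset.mem_insert, Finset.mem_image, Prod.mk.injEq, true_and,
    Prod.exists, shift]
  refine or_congr_right ⟨?_, fun h => ⟨0, j, h.1, by simp [h.2]⟩⟩
  rintro ⟨a, b, h, e⟩
  split_ifs at e with h1 <;> simp_all

lemma succ_mem_splitPoints (T : TreeLikeTableau) (A : Finset ℕ) (hA : A.Nonempty) (i j : ℕ) :
    (i + 1, j) ∈ T.splitPoints A hA ↔ (i, j) ∈ T.points ∧ (i = 0 → j ∈ A) := by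
  simp only [splitPoints, Finset.mem_insert, Finset.mem_image, Prod.mk.injEq, shift,
    Prod.exists, Nat.add_eq_zero_iff, one_ne_zero, and_false, false_and, false_or]
  refine ⟨?_, fun h => ⟨i, j, h.1, ?_⟩⟩
  · rintro ⟨a, b, h, e⟩
    split_ifs at e with h1
    · simp only [Prod.mk.injEq] at e
      omega
    · simp only [Prod.mk.injEq, add_left_inj] at e
      obtain ⟨rfl, rfl⟩ := e
      exact ⟨h, fun h0 => by_contra fun h2 => h1 ⟨h0, h2⟩⟩
  · rw [if_neg]
    rintro ⟨h0, h1⟩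
    exact h1 (h.2 h0)

/-- Split the first row in two: the points of the first row in the columns `A` move to a new
second row, the leftmost of them being also kept in the first row. -/
def split (T : TreeLikeTableau) (A : Finset ℕ) (hA : A.Nonempty) (hT : A ⊆ T.top) :
    TreeLikeTableau where
  shape :=
    { cells := T.splitCells
      isLowerSet := by
        rintro ⟨a, b⟩ ⟨c, d⟩ ⟨h1, h2⟩ h
        simp only [Finset.mem_coe, mem_splitCells] at h ⊢
        exact T.mem_shape_of_le (Nat.sub_le_sub_right h1 1) h2 h }
  points := T.splitPoints A hA
  points_subset := by
    rintro ⟨i, j⟩ h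
    rw [mem_splitCells]
    cases i with
    | zero =>
      rw [zero_mem_splitPoints] at h
      rcases h with rfl | h
      · exact T.points_subset ((T.mem_top _).1 (hT (A.min'_mem hA)))
      · exact T.points_subset h.1
    | succ i => exact T.points_subset ((T.succ_mem_splitPoints A hA i j).1 h).1
  root_mem := by
    rw [zero_mem_splitPoints]
    by_cases h : 0 ∈ A
    · have := A.min'_le 0 h
      omega
    · exact Or.inr ⟨T.root_mem, h⟩
  point_cond := by
    have htop : ∀ j ∈ A, (0, j) ∈ T.points := fun j hj => (T.mem_top j).1 (hT hj)
    have hmin := A.min'_mem hA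
    rintro ⟨i, j⟩ hp h0
    simp only
    rcases i with _ | _ | i
    · have hj : j ≠ 0 := by rintro rfl; exact h0 rfl
      refine Or.inr ⟨⟨0, by omega, ?_⟩, by simp⟩
      rw [zero_mem_splitPoints]
      by_cases h : 0 ∈ A
      · have := A.min'_le 0 h
        omega
      · exact Or.inr ⟨T.root_mem, h⟩
    · have hj := ((T.succ_mem_splitPoints A hA 0 j).1 hp).2 rfl
      have e1 : (∃ r < 0 + 1, (r, j) ∈ T.splitPoints A hA) ↔ j = A.min' hA := by
        simp [zero_mem_splitPoints, hj]
      have e2 : (∃ c < j, (0 + 1, c) ∈ T.splitPoints A hA) ↔ j ≠ A.min' hA := by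
        simp only [succ_mem_splitPoints]
        constructor
        · rintro ⟨c, hc, -, hcA⟩ rfl
          exact absurd (A.min'_le c (hcA trivial)) (by omega)
        · intro h
          exact ⟨_, lt_of_le_of_ne (A.min'_le j hj) h.symm, htop _ hmin, fun _ => hmin⟩
      rw [e1, e2]
      by_cases h : j = A.min' hA
      · exact Or.inl ⟨h, fun h' => h' h⟩
      · exact Or.inr ⟨h, h⟩
    · have hp' := ((T.succ_mem_splitPoints A hA (i + 1) j).1 hp).1
      have e1 : (∃ r < i + 1 + 1, (r, j) ∈ T.splitPoints A hA) ↔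
          ∃ r < i + 1, (r, j) ∈ T.points := by
        constructor
        · rintro ⟨r, hr, h⟩
          cases r with
          | zero =>
            refine ⟨0, by omega, ?_⟩
            rcases (T.zero_mem_splitPoints A hA j).1 h with rfl | h
            · exact htop _ hmin
            · exact h.1
          | succ r => exact ⟨r, by omega, ((T.succ_mem_splitPoints A hA r j).1 h).1⟩
        · rintro ⟨r, hr, h⟩
          by_cases hA' : r = 0 ∧ j ∉ A
          · obtain ⟨rfl, hjA⟩ := hA'
            exact ⟨0, by omega, (T.zero_mem_splitPoints A hA j).2 (Or.inr ⟨h, hjA⟩)⟩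
          · exact ⟨r + 1, by omega, (T.succ_mem_splitPoints A hA r j).2 ⟨h, by tauto⟩⟩
      have e2 : ∀ c, (i + 1 + 1, c) ∈ T.splitPoints A hA ↔ (i + 1, c) ∈ T.points := fun c => by
        simp [succ_mem_splitPoints]
      simp only [e1, e2]
      exact T.point_cond _ hp' (by simp)
  no_empty_row := by
    intro i j h
    rw [mem_splitCells] at h
    rcases i with _ | _ | i
    · exact ⟨_, (T.zero_mem_splitPoints A hA _).2 (Or.inl rfl)⟩
    · have hmin := A.min'_mem hA
      exact ⟨_, (T.succ_mem_splitPoints A hA 0 _).2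
        ⟨(T.mem_top _).1 (hT hmin), fun _ => hmin⟩⟩
    · obtain ⟨c, hc⟩ := T.no_empty_row _ _ h
      exact ⟨c, (T.succ_mem_splitPoints A hA _ _).2 ⟨hc, by simp⟩⟩
  no_empty_col := by
    intro i j h
    rw [mem_splitCells] at h
    obtain ⟨r, hr⟩ := T.no_empty_col _ _ h
    by_cases hA' : r = 0 ∧ j ∉ A
    · obtain ⟨rfl, hjA⟩ := hA'
      exact ⟨0, (T.zero_mem_splitPoints A hA j).2 (Or.inr ⟨hr, hjA⟩)⟩
    · exact ⟨r + 1, (T.succ_mem_splitPoints A hA r j).2 ⟨hr, by tauto⟩⟩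

section Split

variable (T : TreeLikeTableau) (A : Finset ℕ) (hA : A.Nonempty) (hT : A ⊆ T.top)

@[simp]
lemma mem_split_shape (i j : ℕ) :
    (i, j) ∈ (T.split A hA hT).shape.cells ↔ (i - 1, j) ∈ T.shape.cells :=
  T.mem_splitCells i j

@[simp]
lemma zero_mem_split_points (j : ℕ) :
    (0, j) ∈ (T.split A hA hT).points ↔ j = A.min' hA ∨ ((0, j) ∈ T.points ∧ j ∉ A) :=
  T.zero_mem_splitPoints A hA j

@[simp]
lemma succ_mem_split_points (i j : ℕ) :
    (i + 1, j) ∈ (T.split A hA hT).points ↔ (i, j) ∈ T.points ∧ (i = 0 → j ∈ A) :=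
  T.succ_mem_splitPoints A hA i j

lemma one_mem_split_points (j : ℕ) : (1, j) ∈ (T.split A hA hT).points ↔ j ∈ A := by
  have h := T.succ_mem_split_points A hA hT 0 j
  rw [zero_add] at h
  rw [h]
  exact ⟨fun h => h.2 rfl, fun h => ⟨(T.mem_top j).1 (hT h), fun _ => h⟩⟩

lemma zero_mem_points_iff_split (j : ℕ) :
    (0, j) ∈ T.points ↔
      (0, j) ∈ (T.split A hA hT).points ∨ (1, j) ∈ (T.split A hA hT).points := by
  rw [one_mem_split_points, zero_mem_split_points]
  have h1 : j ∈ A → (0, j) ∈ T.points := fun h => (T.mem_top j).1 (hT h)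
  have h2 : j = A.min' hA → j ∈ A := by rintro rfl; exact A.min'_mem hA
  tauto

lemma size_split : (T.split A hA hT).size = T.size + 1 := by
  have : (0, A.min' hA) ∉ T.points.image (shift A) := by
    simp only [Finset.mem_image, not_exists, not_and, shift]
    rintro ⟨a, b⟩ - h
    split_ifs at h with h1
    · simp only [Prod.mk.injEq] at h h1
      exact h1.2 (h.2 ▸ A.min'_mem hA)
    · simp at h
  exact (Finset.card_insert_of_notMem this).trans
    (congrArg (· + 1) (Finset.card_image_of_injective _ (shift_injective A)))

lemma card_top_split : (T.split A hA hT).top.card + A.card = T.top.card + 1 := by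
  have : (T.split A hA hT).top = insert (A.min' hA) (T.top \ A) := by
    ext j
    simp
  rw [this, Finset.card_insert_of_notMem (by simp [A.min'_mem hA]), add_right_comm,
    Finset.card_sdiff_add_card_eq_card hT]

lemma tip_split : (T.split A hA hT).tip = ∅ := by
  ext j
  simp only [mem_tip, Finset.notMem_empty, iff_false, not_and]
  intro h h1
  have h2 := (T.split A hA hT).points_subset h
  rw [mem_split_shape] at h1 h2
  exact absurd h2 h1

lemma oc_split : (T.split A hA hT).oc + (T.tip \ A).card = T.oc := by
  have h : (T.split A hA hT).occCorners =
      (T.occCorners.filter fun p => ¬ (p.1 = 0 ∧ p.2 ∉ A)).image (shift A) := by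
    ext ⟨i, j⟩
    simp only [Finset.mem_image, Finset.mem_filter, Prod.exists, mem_occCorners,
      mem_split_shape, Nat.add_sub_cancel]
    constructor
    · rintro ⟨h, h1, h2⟩
      cases i with
      | zero =>
        have h3 := (T.split A hA hT).points_subset h
        rw [mem_split_shape] at h3
        exact absurd h3 h1
      | succ i =>
        rw [succ_mem_split_points] at h
        have h3 : ¬ (i = 0 ∧ j ∉ A) := fun h' => h'.2 (h.2 h'.1)
        exact ⟨i, j, ⟨⟨h.1, h1, h2⟩, h3⟩, by simp only [shift, if_neg h3]⟩
    · rintro ⟨a, b, ⟨⟨h, h1, h2⟩, h3⟩, e⟩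
      simp only [shift, if_neg h3, Prod.mk.injEq] at e
      obtain ⟨rfl, rfl⟩ := e
      refine ⟨?_, h1, h2⟩
      rw [succ_mem_split_points]
      exact ⟨h, fun h0 => by_contra fun h4 => h3 ⟨h0, h4⟩⟩
  rw [oc, h, Finset.card_image_of_injective _ (shift_injective A), oc, ← T.occCorners_row_zero A,
    ← Finset.card_filter_add_card_filter_not (s := T.occCorners) (fun p => p.1 = 0 ∧ p.2 ∉ A),
    add_comm]

end Split

lemma split_injective {T T' : TreeLikeTableau} {A A' : Finset ℕ} {hA : A.Nonempty}
    {hA' : A'.Nonempty} {hT : A ⊆ T.top} {hT' : A' ⊆ T'.top}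
    (h : T.split A hA hT = T'.split A' hA' hT') : T = T' ∧ A = A' := by
  refine ⟨eq_of_mem_iff (fun i j => ?_) fun i j => ?_, ?_⟩
  · have h1 := T.mem_split_shape A hA hT (i + 1) j
    rw [h, mem_split_shape] at h1
    exact h1.symm
  · cases i with
    | zero => rw [T.zero_mem_points_iff_split A hA hT, h, ← zero_mem_points_iff_split]
    | succ i =>
      have h1 := T.succ_mem_split_points A hA hT (i + 1) j
      rw [h, succ_mem_split_points] at h1
      simpa using h1.symm
  · ext j
    rw [← T.one_mem_split_points A hA hT, h, one_mem_split_points]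

/-- A tableau whose first two rows have the same length arises by splitting the first row. -/
lemma exists_split (T : TreeLikeTableau)
    (h : ∀ j, (0, j) ∈ T.shape.cells → (1, j) ∈ T.shape.cells) :
    ∃ (T' : TreeLikeTableau) (A : Finset ℕ) (hA : A.Nonempty) (hT : A ⊆ T'.top),
      T'.split A hA hT = T := by
  have hmemc : ∀ i j, (i, j) ∈ T.shape.cells.filter (fun p => (p.1 + 1, p.2) ∈ T.shape.cells) ↔
      (i + 1, j) ∈ T.shape.cells := fun i j => by
    rw [Finset.mem_filter]
    exact ⟨And.right, fun h => ⟨T.mem_shape_of_le (Nat.le_succ i) le_rfl h, h⟩⟩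
  have hmemp : ∀ i j, (i, j) ∈ T.shape.cells.filter
      (fun p => (p.1 + 1, p.2) ∈ T.points ∨ (p.1 = 0 ∧ p ∈ T.points)) ↔
      (i + 1, j) ∈ T.points ∨ (i = 0 ∧ (i, j) ∈ T.points) := fun i j => by
    rw [Finset.mem_filter]
    refine ⟨And.right, fun h => ⟨?_, h⟩⟩
    rcases h with h | h
    · exact T.mem_shape_of_le (Nat.le_succ i) le_rfl (T.points_subset h)
    · exact T.points_subset h.2
  let T' : TreeLikeTableau :=
    { shape :=
        { cells := T.shape.cells.filter fun p => (p.1 + 1, p.2) ∈ T.shape.cells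
          isLowerSet := by
            rintro ⟨a, b⟩ ⟨c, d⟩ ⟨h1, h2⟩ h
            rw [Finset.mem_coe, hmemc] at h ⊢
            exact T.mem_shape_of_le (Nat.succ_le_succ h1) h2 h }
      points := T.shape.cells.filter
        fun p => (p.1 + 1, p.2) ∈ T.points ∨ (p.1 = 0 ∧ p ∈ T.points)
      points_subset := by
        rintro ⟨i, j⟩ hp
        rw [hmemp] at hp
        rw [hmemc]
        rcases hp with hp | ⟨rfl, hp⟩
        · exact T.points_subset hp
        · exact h j (T.points_subset hp)
      root_mem := (hmemp 0 0).2 (Or.inr ⟨rfl, T.root_mem⟩)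
      point_cond := by
        rintro ⟨i, j⟩ hp h0
        simp only [hmemp] at hp ⊢
        cases i with
        | zero =>
          have hj : j ≠ 0 := by rintro rfl; exact h0 rfl
          exact Or.inr ⟨⟨0, by omega, Or.inr ⟨rfl, T.root_mem⟩⟩, by simp⟩
        | succ i =>
          have hp' : (i + 1 + 1, j) ∈ T.points := by simpa using hp
          have e1 : (∃ r < i + 1, (r + 1, j) ∈ T.points ∨ r = 0 ∧ (r, j) ∈ T.points) ↔
              ∃ r < i + 1 + 1, (r, j) ∈ T.points := by
            constructor
            · rintro ⟨r, hr, h | ⟨rfl, h⟩⟩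
              · exact ⟨r + 1, by omega, h⟩
              · exact ⟨0, by omega, h⟩
            · rintro ⟨r, hr, h⟩
              cases r with
              | zero => exact ⟨0, by omega, Or.inr ⟨rfl, h⟩⟩
              | succ r => exact ⟨r, by omega, Or.inl h⟩
          rw [e1]
          simpa using T.point_cond _ hp' (by simp)
      no_empty_row := by
        intro i j hij
        rw [hmemc] at hij
        obtain ⟨c, hc⟩ := T.no_empty_row _ _ hij
        exact ⟨c, (hmemp i c).2 (Or.inl hc)⟩
      no_empty_col := by
        intro i j hij
        rw [hmemc] at hij
        obtain ⟨r, hr⟩ := T.no_empty_col _ _ hij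
        cases r with
        | zero => exact ⟨0, (hmemp 0 j).2 (Or.inr ⟨rfl, hr⟩)⟩
        | succ r => exact ⟨r, (hmemp r j).2 (Or.inl hr)⟩ }
  have hA1 : ∀ j, j ∈ (T.points.filter fun p => p.1 = 1).image Prod.snd ↔ (1, j) ∈ T.points :=
    fun j => by simp
  generalize (T.points.filter fun p => p.1 = 1).image Prod.snd = A at hA1
  have hA : A.Nonempty := by
    obtain ⟨c, hc⟩ := T.no_empty_row 1 0 (h 0 (T.points_subset T.root_mem))
    exact ⟨c, (hA1 c).2 hc⟩
  have hT : A ⊆ T'.top := fun j hj =>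
    (T'.mem_top j).2 ((hmemp 0 j).2 (Or.inl ((hA1 j).1 hj)))
  refine ⟨T', A, hA, hT, eq_of_mem_iff (fun i j => ?_) fun i j => ?_⟩
  · rw [mem_split_shape]
    refine (hmemc _ _).trans ?_
    cases i with
    | zero => exact ⟨T.mem_shape_of_le (Nat.zero_le _) le_rfl, h j⟩
    | succ i => rfl
  · cases i with
    | zero =>
      rw [zero_mem_split_points, hA1]
      have hmin := (hA1 _).1 (A.min'_mem hA)
      have key : ∀ j, (1, j) ∈ T.points → ((0, j) ∈ T.points ↔ j = A.min' hA) := by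
        intro j hj
        have e1 : (∃ r < 1, (r, j) ∈ T.points) ↔ (0, j) ∈ T.points := by simp
        have e2 : (∃ c < j, (1, c) ∈ T.points) ↔ j ≠ A.min' hA := by
          constructor
          · rintro ⟨c, hc, h⟩ rfl
            exact absurd (A.min'_le c ((hA1 c).2 h)) (by omega)
          · exact fun h => ⟨_, lt_of_le_of_ne (A.min'_le j ((hA1 j).2 hj)) h.symm, hmin⟩
        have := T.point_cond _ hj (by simp)
        simp only [e1, e2] at this
        rcases this with h | h <;> tauto
      have hz := hmemp 0 j
      have hk := key j
      have hm : j = A.min' hA → (1, j) ∈ T.points := by rintro rfl; exact hmin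
      change j = A.min' hA ∨ ((0, j) ∈ T.shape.cells.filter _ ∧ _) ↔ _
      rw [hz]
      simp only [zero_add, true_and]
      tauto
    | succ i =>
      rw [succ_mem_split_points]
      change ((i, j) ∈ T.shape.cells.filter _ ∧ _) ↔ _
      rw [hmemp, hA1]
      rcases i with _ | i
      · simp only [zero_add, true_and, true_implies]
        tauto
      · simp

open Classical in
/-- The tableau obtained from `T` by splitting the first row along `A` when `A` is a nonempty set
of pointed columns of the first row, and by appending a column otherwise. -/
noncomputable def build (T : TreeLikeTableau) (A : Finset ℕ) : TreeLikeTableau :=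
  if h : A.Nonempty ∧ A ⊆ T.top then T.split A h.1 h.2 else T.addCol

lemma build_empty (T : TreeLikeTableau) : T.build ∅ = T.addCol := by
  simp [build]

lemma build_of_nonempty (T : TreeLikeTableau) {A : Finset ℕ} (hA : A.Nonempty)
    (hT : A ⊆ T.top) : T.build A = T.split A hA hT :=
  dif_pos ⟨hA, hT⟩

lemma size_build (T : TreeLikeTableau) (A : Finset ℕ) : (T.build A).size = T.size + 1 := by
  unfold build
  split_ifs with h
  · exact T.size_split A h.1 h.2
  · exact T.size_addCol

lemma card_top_build (T : TreeLikeTableau) {A : Finset ℕ} (hT : A ⊆ T.top) :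
    (T.build A).top.card = T.top.card - A.card + 1 := by
  rcases A.eq_empty_or_nonempty with rfl | hA
  · rw [build_empty, card_top_addCol, Finset.card_empty, Nat.sub_zero]
  · have h1 := T.card_top_split A hA hT
    have h2 := Finset.card_le_card hT
    rw [build_of_nonempty T hA hT]
    omega

lemma oc_build (T : TreeLikeTableau) {A : Finset ℕ} (hT : A ⊆ T.top) :
    (T.build A).oc + (T.tip \ A).card = T.oc + if A = ∅ then 1 else 0 := by
  rcases A.eq_empty_or_nonempty with rfl | hA
  · simp [build_empty, oc_addCol]
  · rw [build_of_nonempty T hA hT, oc_split, if_neg hA.ne_empty, add_zero]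

lemma card_tip_build (T : TreeLikeTableau) {A : Finset ℕ} (hT : A ⊆ T.top) :
    (T.build A).tip.card = if A = ∅ then 1 else 0 := by
  rcases A.eq_empty_or_nonempty with rfl | hA
  · simp [build_empty, tip_addCol]
  · rw [build_of_nonempty T hA hT, tip_split, if_neg hA.ne_empty, Finset.card_empty]

lemma build_injective {T T' : TreeLikeTableau} {A A' : Finset ℕ} (hT : A ⊆ T.top)
    (hT' : A' ⊆ T'.top) (h : T.build A = T'.build A') : T = T' ∧ A = A' := by
  have ht := T.card_tip_build hT
  rw [h, T'.card_tip_build hT'] at ht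
  rcases A.eq_empty_or_nonempty with rfl | hA
  · obtain rfl : A' = ∅ := by
      by_contra hne
      simp [hne] at ht
    rw [build_empty, build_empty] at h
    exact ⟨addCol_injective h, rfl⟩
  · have hA' : A'.Nonempty := by
      rw [Finset.nonempty_iff_ne_empty]
      rintro rfl
      simp [hA.ne_empty] at ht
    rw [build_of_nonempty T hA hT, build_of_nonempty T' hA' hT'] at h
    exact split_injective h

lemma exists_build (T : TreeLikeTableau) (h : T.size ≠ 1) :
    ∃ (T' : TreeLikeTableau) (A : Finset ℕ), A ⊆ T'.top ∧ T'.build A = T := by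
  by_cases h0 : ∀ j, (0, j) ∈ T.shape.cells → (1, j) ∈ T.shape.cells
  · obtain ⟨T', A, hA, hT, e⟩ := T.exists_split h0
    exact ⟨T', A, hT, (T'.build_of_nonempty hA hT).trans e⟩
  · push Not at h0
    obtain ⟨j, h1, h2⟩ := h0
    obtain ⟨T', e⟩ := T.exists_addCol h h1 h2
    exact ⟨T', ∅, Finset.empty_subset _, T'.build_empty.trans e⟩

open Classical in
/-- The tree-like tableaux of size `n + 1`. -/
noncomputable def tableaux : ℕ → Finset TreeLikeTableau
  | 0 => {single}
  | n + 1 => ((tableaux n).sigma fun T => T.top.powerset).image fun x => x.1.build x.2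

lemma mem_tableaux (n : ℕ) (T : TreeLikeTableau) : T ∈ tableaux n ↔ T.size = n + 1 := by
  induction n generalizing T with
  | zero =>
    rw [tableaux, Finset.mem_singleton, zero_add]
    exact ⟨fun h => h ▸ Finset.card_singleton _, eq_single⟩
  | succ n ih =>
    simp only [tableaux, Finset.mem_image, Finset.mem_sigma, ih, Finset.mem_powerset,
      Sigma.exists]
    constructor
    · rintro ⟨T', A, ⟨h, -⟩, rfl⟩
      rw [size_build, h]
    · intro h
      obtain ⟨T', A, hT, rfl⟩ := T.exists_build (by omega)
      rw [size_build] at h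
      exact ⟨T', A, ⟨by omega, hT⟩, rfl⟩

lemma sum_tableaux_succ {M : Type*} [AddCommMonoid M] (n : ℕ) (f : TreeLikeTableau → M) :
    ∑ T ∈ tableaux (n + 1), f T = ∑ T ∈ tableaux n, ∑ A ∈ T.top.powerset, f (T.build A) := by
  classical
  rw [tableaux, Finset.sum_image, Finset.sum_sigma]
  rintro ⟨T, A⟩ h ⟨T', A'⟩ h' e
  simp only [Finset.coe_sigma, Set.mem_sigma_iff, Finset.mem_coe, Finset.mem_powerset] at h h'
  obtain ⟨rfl, rfl⟩ := build_injective h.2 h'.2 e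
  rfl

lemma top_single : single.top = {0} := by
  ext j
  simp [single]

lemma tip_single : single.tip = {0} := by
  ext j
  simp [single, -YoungDiagram.mem_cells]

lemma oc_single : single.oc = 1 := by
  have : single.occCorners = {(0, 0)} := by
    ext ⟨i, j⟩
    simp only [mem_occCorners, single, Finset.mem_singleton, Prod.mk.injEq]
    omega
  rw [oc, this, Finset.card_singleton]

lemma sum_pow_card_top_zero (u : ℕ) : ∑ T ∈ tableaux 0, u ^ T.top.card = u := by
  simp [tableaux, top_single]

lemma sum_pow_card_top_succ (n u : ℕ) :
    ∑ T ∈ tableaux (n + 1), u ^ T.top.card = u * ∑ T ∈ tableaux n, (u + 1) ^ T.top.card := by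
  rw [sum_tableaux_succ, Finset.mul_sum]
  refine Finset.sum_congr rfl fun T _ => ?_
  rw [add_comm u 1, ← Finset.sum_pow_mul_eq_add_pow, Finset.mul_sum]
  refine Finset.sum_congr rfl fun A hA => ?_
  rw [T.card_top_build (Finset.mem_powerset.1 hA), pow_succ, one_pow]
  ring

lemma sum_pow_card_top (n u : ℕ) :
    ∑ T ∈ tableaux n, u ^ T.top.card = u.ascFactorial (n + 1) := by
  induction n generalizing u with
  | zero => simp [sum_pow_card_top_zero, Nat.ascFactorial]
  | succ n ih =>
    rw [sum_pow_card_top_succ, ih, Nat.ascFactorial_succ (k := n + 1)]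
    exact Nat.succ_ascFactorial u (n + 1)

lemma sum_card_tip_succ (n u : ℕ) :
    ∑ T ∈ tableaux (n + 1), T.tip.card * u ^ T.top.card =
      u * ∑ T ∈ tableaux n, u ^ T.top.card := by
  rw [sum_tableaux_succ, Finset.mul_sum]
  refine Finset.sum_congr rfl fun T _ => ?_
  rw [Finset.sum_eq_single_of_mem ∅ (Finset.empty_mem_powerset _)]
  · rw [T.card_tip_build (Finset.empty_subset _), T.card_top_build (Finset.empty_subset _)]
    simp [pow_succ']
  · intro A hA hne
    rw [T.card_tip_build (Finset.mem_powerset.1 hA), if_neg hne, zero_mul]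

/-- Subsets of the first row weighted by the number of tips they miss. -/
lemma sum_card_tip_sdiff (T : TreeLikeTableau) (u : ℕ) :
    (u + 1) * ∑ A ∈ T.top.powerset, (T.tip \ A).card * u ^ (T.top.card - A.card) =
      u * (T.tip.card * (u + 1) ^ T.top.card) := by
  have h : ∀ A, (T.tip \ A).card = ∑ x ∈ T.tip, if x ∈ A then 0 else 1 := fun A => by
    rw [Finset.card_eq_sum_ones, Finset.sdiff_eq_filter, Finset.sum_filter]
    simp
  simp only [h, Finset.sum_mul]
  rw [Finset.sum_comm, Finset.mul_sum, ← smul_eq_mul (T.tip.card), ← Finset.sum_const,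
    Finset.mul_sum]
  refine Finset.sum_congr rfl fun x hx => ?_
  have hx' := T.tip_subset_top hx
  have hc : (T.top.erase x).card + 1 = T.top.card := Finset.card_erase_add_one hx'
  have : ∑ A ∈ T.top.powerset, (if x ∈ A then 0 else 1) * u ^ (T.top.card - A.card) =
      u * ∑ A ∈ (T.top.erase x).powerset, 1 ^ A.card * u ^ ((T.top.erase x).card - A.card) := by
    have hp : (T.top.erase x).powerset = T.top.powerset.filter fun A => x ∉ A := by
      ext A
      simp [Finset.subset_erase]
    rw [hp, Finset.sum_filter, Finset.mul_sum]
    refine Finset.sum_congr rfl fun A hA => ?_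
    split_ifs with hxA
    · simp_all
    · have hle : A.card ≤ (T.top.erase x).card := Finset.card_le_card
        (Finset.subset_erase.2 ⟨Finset.mem_powerset.1 hA, hxA⟩)
      rw [← hc, Nat.sub_add_comm hle, pow_succ]
      ring
  rw [this, Finset.sum_pow_mul_eq_add_pow, ← hc]
  ring

lemma sum_card_tip_eq (n u : ℕ) :
    u * ∑ T ∈ tableaux n, T.tip.card * (u + 1) ^ T.top.card =
      (u + 1) * ∑ T ∈ tableaux n, u ^ T.top.card := by
  cases n with
  | zero =>
    rw [sum_pow_card_top_zero]
    simp [tableaux, top_single, tip_single, mul_comm]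
  | succ n =>
    rw [sum_card_tip_succ, sum_pow_card_top_succ]
    ring

lemma sum_oc_mul_pow_succ (n u : ℕ) :
    ∑ T ∈ tableaux (n + 1), T.oc * u ^ T.top.card =
      u * ∑ T ∈ tableaux n, T.oc * (u + 1) ^ T.top.card := by
  have h1 : ∑ T ∈ tableaux (n + 1), T.oc * u ^ T.top.card +
      u * ∑ T ∈ tableaux n, ∑ A ∈ T.top.powerset,
        (T.tip \ A).card * u ^ (T.top.card - A.card) =
      u * ∑ T ∈ tableaux n, T.oc * (u + 1) ^ T.top.card +
      u * ∑ T ∈ tableaux n, u ^ T.top.card := by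
    rw [sum_tableaux_succ, Finset.mul_sum, Finset.mul_sum, Finset.mul_sum,
      ← Finset.sum_add_distrib, ← Finset.sum_add_distrib]
    refine Finset.sum_congr rfl fun T _ => ?_
    have h2 : u ^ T.top.card = ∑ A ∈ T.top.powerset,
        (if A = ∅ then 1 else 0) * u ^ (T.top.card - A.card) := by
      rw [Finset.sum_eq_single_of_mem ∅ (Finset.empty_mem_powerset _)]
      · simp
      · intro A _ hne
        rw [if_neg hne, zero_mul]
    rw [add_comm u 1, ← Finset.sum_pow_mul_eq_add_pow, h2]
    simp only [Finset.mul_sum]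
    rw [← Finset.sum_add_distrib, ← Finset.sum_add_distrib]
    refine Finset.sum_congr rfl fun A hA => ?_
    rw [T.card_top_build (Finset.mem_powerset.1 hA), pow_succ, one_pow]
    have := T.oc_build (Finset.mem_powerset.1 hA)
    calc _ = ((T.build A).oc + (T.tip \ A).card) * (u * u ^ (T.top.card - A.card)) := by ring
      _ = _ := by rw [this]; ring
  have h3 : u * ∑ T ∈ tableaux n, ∑ A ∈ T.top.powerset,
      (T.tip \ A).card * u ^ (T.top.card - A.card) = u * ∑ T ∈ tableaux n, u ^ T.top.card := by
    refine Nat.eq_of_mul_eq_mul_left (Nat.succ_pos u) ?_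
    rw [Nat.succ_eq_add_one, mul_left_comm, Finset.mul_sum]
    simp only [sum_card_tip_sdiff]
    rw [← Finset.mul_sum, sum_card_tip_eq, mul_left_comm]
  omega

lemma sum_oc_mul_pow (n u : ℕ) :
    ∑ T ∈ tableaux n, T.oc * u ^ T.top.card = ∑ T ∈ tableaux n, u ^ T.top.card := by
  induction n generalizing u with
  | zero => simp [tableaux, oc_single]
  | succ n ih => rw [sum_oc_mul_pow_succ, ih, sum_pow_card_top_succ]

end TreeLikeTableau

/-- The total number of occupied corners over all tree-like tableaux of size `n`
equals `n!`. -/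
theorem total_occupied_corners (n : ℕ) (hn : 1 ≤ n)
    (S : Finset TreeLikeTableau) (hS : ∀ T, T ∈ S ↔ T.size = n) :
    ∑ T ∈ S, T.oc = n.factorial := by
  obtain ⟨m, rfl⟩ := Nat.exists_eq_add_of_le' hn
  obtain rfl : S = TreeLikeTableau.tableaux m :=
    Finset.ext fun T => (hS T).trans (TreeLikeTableau.mem_tableaux m T).symm
  have h := TreeLikeTableau.sum_oc_mul_pow m 1
  rw [TreeLikeTableau.sum_pow_card_top, Nat.one_ascFactorial] at h
  simpa using h
end

section
/- The total number of occupied corners over all symmetric tree-like tableaux of size 2n+1 equals 2^n · n!. -/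
open Polynomial

/-- A tree-like tableau is symmetric if it is invariant under reflection
across its main diagonal. -/
def TreeLikeTableau.IsSymmetric (T : TreeLikeTableau) : Prop :=
  T.shape.transpose = T.shape ∧ ∀ p : ℕ × ℕ, p ∈ T.points ↔ (p.2, p.1) ∈ T.points

namespace SymmetricTableau

/-- The cells of the self-conjugate diagram coded by a word: starting from a single cell, the letter
`false` adds a cell at the end of the first row and of the first column, while `true` adds a new
first row and a new first column, each one longer than the previous ones. -/
def Cell : List Bool → ℕ → ℕ → Prop
  | [], i, j => i = 0 ∧ j = 0
  | false :: w, i, j => Cell w i j ∨ (i = w.length + 1 ∧ j = 0) ∨ (i = 0 ∧ j = w.length + 1)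
  | true :: w, i, j => (i = 0 ∧ j ≤ w.length + 1) ∨ (j = 0 ∧ i ≤ w.length + 1) ∨
      (0 < i ∧ 0 < j ∧ Cell w (i - 1) (j - 1))

theorem cell_true_succ (w : List Bool) (i j : ℕ) :
    Cell (true :: w) (i + 1) (j + 1) ↔ Cell w i j := by
  simp [Cell]

theorem cell_true_zero_left (w : List Bool) (j : ℕ) :
    Cell (true :: w) 0 j ↔ j ≤ w.length + 1 := by
  simp +contextual [Cell]

theorem cell_true_zero_right (w : List Bool) (i : ℕ) :
    Cell (true :: w) i 0 ↔ i ≤ w.length + 1 := by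
  simp +contextual [Cell]

theorem Cell.le {w : List Bool} {i j : ℕ} (h : Cell w i j) : i ≤ w.length ∧ j ≤ w.length := by
  induction w generalizing i j with
  | nil => simp only [Cell] at h; omega
  | cons b w ih =>
    simp only [List.length_cons]
    cases b with
    | false =>
      rcases h with h | h | h
      · have := ih h; omega
      all_goals omega
    | true =>
      rcases h with h | h | ⟨_, _, h⟩
      · omega
      · omega
      · have := ih h; omega

theorem Cell.symm {w : List Bool} {i j : ℕ} (h : Cell w i j) : Cell w j i := by
  induction w generalizing i j with
  | nil => exact ⟨h.2, h.1⟩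
  | cons b w ih =>
    cases b with
    | false =>
      rcases h with h | h | h
      · exact Or.inl (ih h)
      · exact Or.inr (Or.inr h.symm)
      · exact Or.inr (Or.inl h.symm)
    | true =>
      rcases h with h | h | ⟨hi, hj, h⟩
      · exact Or.inr (Or.inl h)
      · exact Or.inl h
      · exact Or.inr (Or.inr ⟨hj, hi, ih h⟩)

theorem cell_zero_right {w : List Bool} {i : ℕ} : Cell w i 0 ↔ i ≤ w.length := by
  refine ⟨fun h => h.le.1, ?_⟩
  induction w generalizing i with
  | nil => intro h; exact ⟨by simpa using h, rfl⟩
  | cons b w ih =>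
    intro h
    simp only [List.length_cons] at h
    cases b with
    | false =>
      rcases h.lt_or_eq with h | h
      · exact Or.inl (ih (by omega))
      · exact Or.inr (Or.inl ⟨h, rfl⟩)
    | true => exact (cell_true_zero_right w i).2 h

theorem cell_zero_left {w : List Bool} {j : ℕ} : Cell w 0 j ↔ j ≤ w.length :=
  ⟨fun h => h.le.2, fun h => (cell_zero_right.2 h).symm⟩

theorem Cell.mono {w : List Bool} {i j i' j' : ℕ} (h : Cell w i j) (hi : i' ≤ i) (hj : j' ≤ j) :
    Cell w i' j' := by
  induction w generalizing i j i' j' with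
  | nil => simp only [Cell] at h ⊢; omega
  | cons b w ih =>
    cases b with
    | false =>
      rcases h with h | ⟨rfl, rfl⟩ | ⟨rfl, rfl⟩
      · exact Or.inl (ih h hi hj)
      · obtain rfl : j' = 0 := by omega
        exact cell_zero_right.2 hi
      · obtain rfl : i' = 0 := by omega
        exact cell_zero_left.2 hj
    | true =>
      rcases Nat.eq_zero_or_pos i' with rfl | hi'
      · exact cell_zero_left.2 (hj.trans h.le.2)
      rcases Nat.eq_zero_or_pos j' with rfl | hj'
      · exact cell_zero_right.2 (hi.trans h.le.1)
      rcases h with h | h | ⟨_, _, h⟩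
      · omega
      · omega
      · exact Or.inr (Or.inr ⟨hi', hj', ih h (by omega) (by omega)⟩)

theorem not_cell_false_one (w : List Bool) : ¬ Cell (false :: w) (w.length + 1) 1 := by
  rintro (h | h | h)
  · have := h.le; omega
  · omega
  · omega

theorem cell_true_one (w : List Bool) : Cell (true :: w) (w.length + 1) 1 :=
  (cell_true_succ w _ 0).2 (cell_zero_right.2 le_rfl)

theorem cell_false_iff {w : List Bool} {i j : ℕ} (hi : i ≤ w.length) (hj : j ≤ w.length) :
    Cell (false :: w) i j ↔ Cell w i j := by
  refine ⟨?_, Or.inl⟩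
  rintro (h | h | h)
  · exact h
  · omega
  · omega

theorem cell_injective {w w' : List Bool} (h : ∀ i j, Cell w i j ↔ Cell w' i j) : w = w' := by
  have hl : w.length = w'.length := by
    have h₁ := (h w.length 0).1 (cell_zero_right.2 le_rfl)
    have h₂ := (h w'.length 0).2 (cell_zero_right.2 le_rfl)
    exact le_antisymm h₁.le.1 h₂.le.1
  induction w generalizing w' with
  | nil => exact (List.length_eq_zero_iff.1 hl.symm).symm
  | cons b w ih =>
    cases w' with
    | nil => simp at hl
    | cons b' w' =>
      have hl' : w.length = w'.length := by simpa using hl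
      have h1 := h (w.length + 1) 1
      cases b <;> cases b'
      · rw [ih (fun i j => ?_) hl']
        by_cases hij : i ≤ w.length ∧ j ≤ w.length
        · have := h i j
          rwa [cell_false_iff hij.1 hij.2, cell_false_iff (hl' ▸ hij.1) (hl' ▸ hij.2)] at this
        · exact ⟨fun hc => absurd hc.le hij, fun hc => absurd (hl' ▸ hc.le) hij⟩
      · exact absurd (h1.2 (hl' ▸ cell_true_one w')) (not_cell_false_one w)
      · exact absurd (h1.1 (cell_true_one w)) (hl' ▸ not_cell_false_one w')
      · rw [ih (fun i j => ?_) hl']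
        rw [← cell_true_succ, h, cell_true_succ]

theorem exists_word (n : ℕ) (D : ℕ → ℕ → Prop) (hsymm : ∀ i j, D i j → D j i)
    (hmono : ∀ i j i' j', D i j → i' ≤ i → j' ≤ j → D i' j')
    (hn : D n 0) (hn' : ¬ D (n + 1) 0) :
    ∃ w : List Bool, w.length = n ∧ ∀ i j, Cell w i j ↔ D i j := by
  have hle : ∀ i j, D i j → i ≤ n ∧ j ≤ n := fun i j h =>
    ⟨not_lt.1 fun hlt => hn' (hmono _ _ _ _ h hlt (Nat.zero_le _)),
      not_lt.1 fun hlt => hn' (hmono _ _ _ _ (hsymm _ _ h) hlt (Nat.zero_le _))⟩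
  induction n generalizing D with
  | zero =>
    refine ⟨[], rfl, fun i j => ⟨?_, fun h => ?_⟩⟩
    · rintro ⟨rfl, rfl⟩; exact hn
    · simpa [Cell] using hle i j h
  | succ n ih =>
    by_cases h1 : D (n + 1) 1
    · obtain ⟨w, hw, hD⟩ := ih (fun i j => D (i + 1) (j + 1)) (fun i j => hsymm _ _)
        (fun i j i' j' h hi hj => hmono _ _ _ _ h (by omega) (by omega)) h1
        (fun h => by have := hle _ _ h; omega)
        (fun i j h => by have := hle _ _ h; omega)
      refine ⟨true :: w, by simp [hw], fun i j => ?_⟩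
      rcases i with _ | i
      · rw [cell_true_zero_left, hw]
        exact ⟨fun h => hmono _ _ _ _ (hsymm _ _ hn) le_rfl h, fun h => (hle _ _ h).2⟩
      rcases j with _ | j
      · rw [cell_true_zero_right, hw]
        exact ⟨fun h => hmono _ _ _ _ hn h le_rfl, fun h => (hle _ _ h).1⟩
      rw [cell_true_succ, hD]
    · obtain ⟨w, hw, hD⟩ := ih (fun i j => D i j ∧ i ≤ n ∧ j ≤ n)
        (fun i j h => ⟨hsymm _ _ h.1, h.2.2, h.2.1⟩)
        (fun i j i' j' h hi hj => ⟨hmono _ _ _ _ h.1 hi hj, by omega, by omega⟩)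
        ⟨hmono _ _ _ _ hn (by omega) le_rfl, by omega⟩ (by omega) (fun i j h => h.2)
      refine ⟨false :: w, by simp [hw], fun i j => ?_⟩
      simp only [Cell, hD, hw]
      constructor
      · rintro (h | ⟨rfl, rfl⟩ | ⟨rfl, rfl⟩)
        · exact h.1
        · exact hn
        · exact hsymm _ _ hn
      · intro h
        have hij := hle _ _ h
        by_cases hi : i = n + 1
        · subst hi
          refine Or.inr (Or.inl ⟨rfl, ?_⟩)
          by_contra hj
          exact h1 (hmono _ _ _ _ h le_rfl (by omega))
        by_cases hj : j = n + 1
        · subst hj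
          refine Or.inr (Or.inr ⟨?_, rfl⟩)
          by_contra hi
          exact h1 (hmono _ _ _ _ (hsymm _ _ h) le_rfl (by omega))
        exact Or.inl ⟨h, by omega, by omega⟩

/-- The words of length `n`. -/
def words : ℕ → Finset (List Bool)
  | 0 => {[]}
  | n + 1 => (words n).image (List.cons false) ∪ (words n).image (List.cons true)

theorem mem_words {n : ℕ} {w : List Bool} : w ∈ words n ↔ w.length = n := by
  induction n generalizing w with
  | zero => simp [words]
  | succ n ih =>
    cases w with
    | nil => simp [words]
    | cons b w => cases b <;> simp [words, ih]

theorem sum_words_succ (n : ℕ) (F : List Bool → ℤ) :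
    ∑ w ∈ words (n + 1), F w = ∑ w ∈ words n, (F (false :: w) + F (true :: w)) := by
  rw [words, Finset.sum_union, Finset.sum_image, Finset.sum_image, Finset.sum_add_distrib]
  · simp
  · simp
  · simp only [Finset.disjoint_left, Finset.mem_image, not_exists, not_and]
    rintro _ ⟨w, -, rfl⟩ w' -
    simp

/-- A symmetric filling of the diagram of `w` is coded by the column `f i` of the leftmost point of
the row `i`. -/
structure IsFilling (w : List Bool) (f : ℕ → ℕ) : Prop where
  zero : f 0 = 0
  eq_zero : ∀ i, w.length < i → f i = 0
  lt : ∀ i, i ≠ 0 → f (f i) < i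
  cell : ∀ i, i ≤ w.length → Cell w i (f i)

theorem IsFilling.le {w : List Bool} {f : ℕ → ℕ} (hf : IsFilling w f) (i : ℕ) :
    f i ≤ w.length := by
  by_cases hi : i ≤ w.length
  · exact (hf.cell i hi).le.2
  · simp [hf.eq_zero i (by omega)]

theorem finite_isFilling (w : List Bool) : {f | IsFilling w f}.Finite := by
  have hfin : Finite (Fin (w.length + 1) → Fin (w.length + 1)) := inferInstance
  refine Set.Finite.of_injOn
    (f := fun f (i : Fin (w.length + 1)) => (⟨min (f i) w.length, by omega⟩ : Fin (w.length + 1)))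
    (t := Set.univ) (fun _ _ => Set.mem_univ _) ?_ Set.finite_univ
  intro f hf g hg h
  ext i
  by_cases hi : i ≤ w.length
  · have := congrArg Fin.val (congrFun h ⟨i, by omega⟩)
    simp only [min_eq_left (hf.le _), min_eq_left (hg.le _)] at this
    exact this
  · rw [hf.eq_zero i (by omega), hg.eq_zero i (by omega)]

/-- The finite set of fillings of the diagram of `w`. -/
noncomputable def fillings (w : List Bool) : Finset (ℕ → ℕ) := (finite_isFilling w).toFinset

theorem mem_fillings {w : List Bool} {f : ℕ → ℕ} : f ∈ fillings w ↔ IsFilling w f := by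
  simp [fillings]

theorem fillings_false (w : List Bool) : fillings (false :: w) = fillings w := by
  ext f
  rw [mem_fillings, mem_fillings]
  constructor
  · intro hf
    refine ⟨hf.zero, fun i hi => ?_, hf.lt, fun i hi => ?_⟩
    · rcases Nat.lt_or_ge (w.length + 1) i with h | h
      · exact hf.eq_zero i (by simpa using h)
      · rcases hf.cell i (by simpa using h) with h | h | h
        · have := h.le; omega
        · exact h.2
        · omega
    · rcases hf.cell i (by simp; omega) with h | h | h
      · exact h
      · omega
      · have := hf.zero
        rw [h.1] at h
        omega
  · intro hf
    refine ⟨hf.zero, fun i hi => hf.eq_zero i (by simp at hi; omega), hf.lt, fun i hi => ?_⟩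
    rcases Nat.lt_or_ge w.length i with h | h
    · rw [hf.eq_zero i h]; exact cell_zero_right.2 hi
    · exact Or.inl (hf.cell i h)

/-- The rows other than the first one whose leftmost point is in the first column. -/
def zeros (n : ℕ) (f : ℕ → ℕ) : Finset ℕ := {i ∈ Finset.Icc 1 n | f i = 0}

theorem mem_zeros {n : ℕ} {f : ℕ → ℕ} {i : ℕ} : i ∈ zeros n f ↔ (1 ≤ i ∧ i ≤ n) ∧ f i = 0 := by
  simp [zeros]

theorem card_zeros_succ {n : ℕ} {f : ℕ → ℕ} (h : f (n + 1) = 0) :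
    (zeros (n + 1) f).card = (zeros n f).card + 1 := by
  have : zeros (n + 1) f = insert (n + 1) (zeros n f) := by
    ext i
    simp only [mem_zeros, Finset.mem_insert]
    constructor
    · rintro ⟨h₁, h₂⟩
      by_cases hi : i = n + 1
      · exact Or.inl hi
      · exact Or.inr ⟨by omega, h₂⟩
    · rintro (rfl | ⟨h₁, h₂⟩)
      · exact ⟨by omega, h⟩
      · exact ⟨by omega, h₂⟩
  rw [this, Finset.card_insert_of_notMem (by simp [mem_zeros])]

/-- The filling obtained by merging the first two rows and columns. -/
def merge (f : ℕ → ℕ) (i : ℕ) : ℕ := if i = 0 then 0 else f (i + 1) - 1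

theorem isFilling_merge {w : List Bool} {f : ℕ → ℕ} (hf : IsFilling (true :: w) f) :
    IsFilling w (merge f) := by
  refine ⟨rfl, fun i hi => ?_, fun i hi => ?_, fun i hi => ?_⟩
  · simp [merge, hf.eq_zero (i + 1) (by simpa using hi)]
  · simp only [merge, hi, if_false]
    split_ifs with h
    · omega
    · have := hf.lt (i + 1) (by omega)
      rw [Nat.sub_add_cancel (by omega)]
      omega
  · simp only [merge]
    split_ifs with h
    · exact cell_zero_right.2 hi
    · have := hf.cell (i + 1) (by simpa using hi)
      rcases h' : f (i + 1) with _ | c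
      · exact cell_zero_right.2 hi
      · rw [h', cell_true_succ] at this
        exact this

/-- The filling obtained by splitting the first column, and symmetrically the first row, into two:
the points of the rows in `U` go to the second column, and the second row has its leftmost point in
column `c`. -/
def split (g : ℕ → ℕ) (c : ℕ) (U : Finset ℕ) : ℕ → ℕ
  | 0 => 0
  | 1 => c
  | i + 2 => if g (i + 1) = 0 then (if i + 1 ∈ U then 1 else 0) else g (i + 1) + 1

theorem merge_split {g : ℕ → ℕ} (hg : g 0 = 0) (c : ℕ) (U : Finset ℕ) :
    merge (split g c U) = g := by
  ext i
  rcases i with _ | i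
  · simp [merge, hg]
  · simp only [merge, split, Nat.succ_ne_zero, if_false]
    split_ifs <;> omega

theorem isFilling_split {w : List Bool} {g : ℕ → ℕ} (hg : IsFilling w g) {c : ℕ} {U : Finset ℕ}
    (hU : U ⊆ zeros w.length g)
    (hc : c = 0 ∨ ∃ z ∈ zeros w.length g, c = z + 1 ∧ z ∉ U ∧ ∀ u ∈ U, z < u) :
    IsFilling (true :: w) (split g c U) := by
  refine ⟨rfl, fun i hi => ?_, fun i hi => ?_, fun i hi => ?_⟩
  · simp only [List.length_cons] at hi
    obtain ⟨k, rfl⟩ : ∃ k, i = k + 2 := ⟨i - 2, by omega⟩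
    have hk : k + 1 ∉ U := fun h => by have := mem_zeros.1 (hU h); omega
    simp [split, hg.eq_zero (k + 1) (by omega), hk]
  · rcases i with _ | _ | k
    · exact absurd rfl hi
    · rcases hc with rfl | ⟨z, hz, rfl, hzU, -⟩
      · simp [split]
      · rw [mem_zeros] at hz
        obtain ⟨z, rfl⟩ : ∃ k, z = k + 1 := ⟨z - 1, by omega⟩
        simp [split, hz.2, hzU]
    · by_cases h0 : g (k + 1) = 0
      · by_cases hkU : k + 1 ∈ U
        · simp only [split, h0, hkU, if_true]
          rcases hc with rfl | ⟨z, hz, rfl, hzU, hlt⟩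
          · omega
          · have := hlt _ hkU
            omega
        · simp [split, h0, hkU]
      · have hlt := hg.lt (k + 1) (by omega)
        obtain ⟨j, hj⟩ : ∃ j, g (k + 1) = j + 1 := ⟨g (k + 1) - 1, by omega⟩
        rw [hj] at hlt
        simp only [split, hj, Nat.succ_ne_zero, if_false]
        split_ifs <;> omega
  · simp only [List.length_cons] at hi
    rcases i with _ | _ | k
    · exact cell_zero_right.2 (by simp)
    · rcases hc with rfl | ⟨z, hz, rfl, hzU, -⟩
      · exact cell_zero_right.2 (by simp)
      · exact (cell_true_succ w 0 z).2 (cell_zero_left.2 (mem_zeros.1 hz).1.2)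
    · simp only [split]
      split_ifs
      · exact (cell_true_succ w (k + 1) 0).2 (cell_zero_right.2 (by omega))
      · exact cell_zero_right.2 (by simpa using hi)
      · exact (cell_true_succ w _ _).2 (hg.cell _ (by omega))

/-- The rows whose leftmost point lies in the second column, with indices shifted by one. -/
def marks (n : ℕ) (f : ℕ → ℕ) : Finset ℕ := {i ∈ zeros n (merge f) | f (i + 1) ≠ 0}

theorem mem_marks {w : List Bool} {f : ℕ → ℕ} {i : ℕ} :
    i ∈ marks w.length f ↔ (1 ≤ i ∧ i ≤ w.length) ∧ f (i + 1) = 1 := by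
  simp only [marks, Finset.mem_filter, mem_zeros, merge]
  constructor
  · rintro ⟨⟨h₁, h₂⟩, h₃⟩
    rw [if_neg (by omega)] at h₂
    exact ⟨h₁, by omega⟩
  · rintro ⟨h₁, h₂⟩
    rw [if_neg (by omega)]
    omega

theorem split_merge {w : List Bool} {f : ℕ → ℕ} (hf : IsFilling (true :: w) f) :
    split (merge f) (f 1) (marks w.length f) = f := by
  ext i
  rcases i with _ | _ | k
  · exact hf.zero.symm
  · rfl
  · simp only [split, mem_marks, merge, Nat.succ_ne_zero, if_false]
    by_cases hk : k + 1 ≤ w.length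
    · split_ifs <;> omega
    · have := hf.eq_zero (k + 2) (by simp; omega)
      simp [this]

theorem marks_split {w : List Bool} {g : ℕ → ℕ} (c : ℕ) {U : Finset ℕ}
    (hU : U ⊆ zeros w.length g) : marks w.length (split g c U) = U := by
  ext i
  rw [mem_marks]
  constructor
  · rintro ⟨h₁, h₂⟩
    obtain ⟨k, rfl⟩ : ∃ k, i = k + 1 := ⟨i - 1, by omega⟩
    simp only [split] at h₂
    split_ifs at h₂ with h h'
    · exact h'
    · omega
  · intro hi
    have := mem_zeros.1 (hU hi)
    obtain ⟨k, rfl⟩ : ∃ k, i = k + 1 := ⟨i - 1, by omega⟩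
    exact ⟨this.1, by simp [split, this.2, hi]⟩

theorem card_zeros_true {w : List Bool} {f : ℕ → ℕ} :
    (zeros (w.length + 1) f).card =
      (zeros w.length (merge f) \ marks w.length f).card + if f 1 = 0 then 1 else 0 := by
  have himage : ((zeros w.length (merge f) \ marks w.length f).image Nat.succ).card =
      (zeros w.length (merge f) \ marks w.length f).card :=
    Finset.card_image_of_injective _ Nat.succ_injective
  have hmem : ∀ i, i ∈ (zeros w.length (merge f) \ marks w.length f).image Nat.succ ↔
      (2 ≤ i ∧ i ≤ w.length + 1) ∧ f i = 0 := by
    intro i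
    simp only [Finset.mem_image, Finset.mem_sdiff, mem_marks, mem_zeros, merge]
    constructor
    · rintro ⟨k, ⟨⟨h₁, h₂⟩, h₃⟩, rfl⟩
      rw [if_neg (by omega)] at h₂
      refine ⟨by omega, ?_⟩
      have : f (k + 1) ≠ 1 := fun h => h₃ ⟨h₁, h⟩
      simp only [Nat.succ_eq_add_one]
      omega
    · rintro ⟨h₁, h₂⟩
      obtain ⟨k, rfl⟩ : ∃ k, i = k + 1 := ⟨i - 1, by omega⟩
      refine ⟨k, ⟨⟨by omega, by simp [h₂]⟩, by omega⟩, rfl⟩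
  rw [← himage]
  split_ifs with h
  · rw [← Finset.card_insert_of_notMem (a := 1) (by rw [hmem]; omega)]
    congr 1
    ext i
    rw [Finset.mem_insert, hmem, mem_zeros]
    constructor
    · rintro ⟨h₁, h₂⟩
      by_cases hi : i = 1
      · exact Or.inl hi
      · exact Or.inr ⟨by omega, h₂⟩
    · rintro (rfl | h')
      · exact ⟨by omega, h⟩
      · exact ⟨by omega, h'.2⟩
  · rw [add_zero]
    congr 1
    ext i
    rw [hmem, mem_zeros]
    constructor
    · rintro ⟨h₁, h₂⟩
      have : i ≠ 1 := by rintro rfl; exact h h₂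
      exact ⟨by omega, h₂⟩
    · rintro h'
      exact ⟨by omega, h'.2⟩

theorem sum_powerset_pow_card_sdiff (Z : Finset ℕ) (x : ℤ) :
    ∑ U ∈ Z.powerset, x ^ ((Z \ U).card + 1) = x * (x + 1) ^ Z.card := by
  rw [add_comm x 1, ← Finset.sum_pow_mul_eq_add_pow, Finset.mul_sum]
  refine Finset.sum_congr rfl fun U hU => ?_
  rw [Finset.card_sdiff_of_subset (Finset.mem_powerset.1 hU), one_pow, one_mul, pow_succ']

open scoped Classical in
theorem sum_fiber_eq_zero {w : List Bool} {g : ℕ → ℕ} (hg : IsFilling w g) (x : ℤ) :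
    ∑ f ∈ fillings (true :: w) with merge f = g ∧ f 1 = 0, x ^ (zeros (w.length + 1) f).card =
      x * (x + 1) ^ (zeros w.length g).card := by
  rw [← sum_powerset_pow_card_sdiff]
  refine Finset.sum_nbij' (marks w.length) (split g 0) ?_ ?_ ?_ ?_ ?_
  · simp only [Finset.mem_filter, Finset.mem_powerset]
    rintro f ⟨-, rfl, -⟩
    exact Finset.filter_subset _ _
  · simp only [Finset.mem_filter, Finset.mem_powerset, mem_fillings]
    intro U hU
    exact ⟨isFilling_split hg hU (Or.inl rfl), merge_split hg.zero _ _, rfl⟩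
  · simp only [Finset.mem_filter, mem_fillings]
    rintro f ⟨hf, rfl, h1⟩
    conv_rhs => rw [← split_merge hf, h1]
  · simp only [Finset.mem_powerset]
    exact fun U hU => marks_split _ hU
  · simp only [Finset.mem_filter]
    rintro f ⟨-, rfl, h1⟩
    rw [card_zeros_true, if_pos h1]

theorem second_row_of_ne_zero {w : List Bool} {f : ℕ → ℕ} (hf : IsFilling (true :: w) f)
    (h1 : f 1 ≠ 0) : f 1 - 1 ∈ zeros w.length (merge f) ∧ f 1 - 1 ∉ marks w.length f ∧
      ∀ u ∈ marks w.length f, f 1 - 1 < u := by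
  have hlt := hf.lt 1 one_ne_zero
  have hle := hf.le 1
  simp only [List.length_cons] at hle
  have h0 : f (f 1) = 0 := by omega
  have hne : f 1 ≠ 1 := fun h => by rw [h, h] at h0; omega
  refine ⟨?_, ?_, ?_⟩
  · rw [mem_zeros]
    refine ⟨by omega, ?_⟩
    rw [merge, if_neg (by omega), Nat.sub_add_cancel (by omega), h0]
  · rw [mem_marks, Nat.sub_add_cancel (by omega), h0]
    omega
  · intro u hu
    rw [mem_marks] at hu
    have := hf.lt (u + 1) (by omega)
    rw [hu.2] at this
    omega

open scoped Classical in
theorem sum_fiber_ne_zero {w : List Bool} {g : ℕ → ℕ} (hg : IsFilling w g) (x : ℤ) :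
    ∑ f ∈ fillings (true :: w) with merge f = g ∧ f 1 ≠ 0, x ^ (zeros (w.length + 1) f).card =
      x * (x + 1) ^ (zeros w.length g).card - x ^ ((zeros w.length g).card + 1) := by
  rw [← sum_powerset_pow_card_sdiff,
    ← Finset.sum_erase_add _ _ (Finset.empty_mem_powerset _), Finset.sdiff_empty,
    add_sub_cancel_right]
  have hmin : ∀ {f : ℕ → ℕ}, IsFilling (true :: w) f → f 1 ≠ 0 →
      sInf (↑(insert (f 1 - 1) (marks w.length f)) : Set ℕ) = f 1 - 1 := by
    intro f hf h1
    obtain ⟨-, -, hlt⟩ := second_row_of_ne_zero hf h1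
    refine le_antisymm (Nat.sInf_le (by simp)) ?_
    refine le_csInf ⟨f 1 - 1, by simp⟩ ?_
    intro u hu
    rcases Finset.mem_insert.1 (Finset.mem_coe.1 hu) with rfl | hu
    · exact le_rfl
    · exact (hlt u hu).le
  have hmem : ∀ {V : Finset ℕ}, V ≠ ∅ → sInf (V : Set ℕ) ∈ V := fun hV =>
    Finset.mem_coe.1 (Nat.sInf_mem (Finset.coe_nonempty.2 (Finset.nonempty_iff_ne_empty.2 hV)))
  refine Finset.sum_nbij' (fun f => insert (f 1 - 1) (marks w.length f))
    (fun V => split g (sInf (V : Set ℕ) + 1) (V.erase (sInf (V : Set ℕ)))) ?_ ?_ ?_ ?_ ?_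
  · simp only [Finset.mem_filter, mem_fillings, Finset.mem_erase, Finset.mem_powerset]
    rintro f ⟨hf, rfl, h1⟩
    exact ⟨Finset.insert_ne_empty _ _, Finset.insert_subset (second_row_of_ne_zero hf h1).1
      (Finset.filter_subset _ _)⟩
  · simp only [Finset.mem_filter, mem_fillings, Finset.mem_erase, Finset.mem_powerset]
    rintro V ⟨hV, hVZ⟩
    refine ⟨isFilling_split hg ((Finset.erase_subset _ _).trans hVZ) (Or.inr
      ⟨_, hVZ (hmem hV), rfl, Finset.notMem_erase _ _, fun u hu => ?_⟩),
      merge_split hg.zero _ _, Nat.succ_ne_zero _⟩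
    rw [Finset.mem_erase] at hu
    exact lt_of_le_of_ne (Nat.sInf_le hu.2) hu.1.symm
  · simp only [Finset.mem_filter, mem_fillings]
    rintro f ⟨hf, rfl, h1⟩
    rw [hmin hf h1, Finset.erase_insert (second_row_of_ne_zero hf h1).2.1,
      Nat.sub_add_cancel (by omega), split_merge hf]
  · simp only [Finset.mem_erase, Finset.mem_powerset]
    rintro V ⟨hV, hVZ⟩
    rw [marks_split _ ((Finset.erase_subset _ _).trans hVZ)]
    simp only [split, Nat.add_sub_cancel]
    exact Finset.insert_erase (hmem hV)
  · simp only [Finset.mem_filter, mem_fillings]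
    rintro f ⟨hf, rfl, h1⟩
    obtain ⟨hz, hz', -⟩ := second_row_of_ne_zero hf h1
    rw [card_zeros_true, if_neg h1, add_zero, Finset.sdiff_insert,
      Finset.card_erase_add_one (Finset.mem_sdiff.2 ⟨hz, hz'⟩)]

open scoped Classical in
theorem sum_fillings_true (w : List Bool) (φ : (ℕ → ℕ) → ℤ) (x : ℤ) :
    ∑ f ∈ fillings (true :: w), φ (merge f) * x ^ (zeros (w.length + 1) f).card =
      2 * x * (∑ g ∈ fillings w, φ g * (x + 1) ^ (zeros w.length g).card) -
        x * ∑ g ∈ fillings w, φ g * x ^ (zeros w.length g).card := by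
  rw [← Finset.sum_fiberwise_of_maps_to (t := fillings w) (g := merge)
    (fun f hf => mem_fillings.2 (isFilling_merge (mem_fillings.1 hf))),
    Finset.mul_sum, Finset.mul_sum, ← Finset.sum_sub_distrib]
  refine Finset.sum_congr rfl fun g hg => ?_
  rw [← Finset.sum_filter_add_sum_filter_not _ (fun f => f 1 = 0), Finset.filter_filter,
    Finset.filter_filter]
  have h₁ : ∀ P : (ℕ → ℕ) → Prop, ∀ [DecidablePred P],
      ∑ f ∈ fillings (true :: w) with merge f = g ∧ P f,
        φ (merge f) * x ^ (zeros (w.length + 1) f).card =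
      φ g * ∑ f ∈ fillings (true :: w) with merge f = g ∧ P f,
        x ^ (zeros (w.length + 1) f).card := by
    intro P _
    rw [Finset.mul_sum]
    refine Finset.sum_congr rfl fun f hf => ?_
    rw [(Finset.mem_filter.1 hf).2.1]
  rw [h₁, h₁, sum_fiber_eq_zero (mem_fillings.1 hg), sum_fiber_ne_zero (mem_fillings.1 hg)]
  ring

open scoped Classical in
/-- The occupied corners below the diagonal. -/
noncomputable def lowerCorners (w : List Bool) (f : ℕ → ℕ) : Finset (ℕ × ℕ) :=
  {p ∈ Finset.range (w.length + 1) ×ˢ Finset.range (w.length + 1) |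
    Cell w p.1 p.2 ∧ ¬ Cell w (p.1 + 1) p.2 ∧ ¬ Cell w p.1 (p.2 + 1) ∧ p.2 < p.1 ∧
      (f p.1 = p.2 ∨ f p.2 = p.1)}

theorem mem_lowerCorners {w : List Bool} {f : ℕ → ℕ} {i j : ℕ} :
    (i, j) ∈ lowerCorners w f ↔ Cell w i j ∧ ¬ Cell w (i + 1) j ∧ ¬ Cell w i (j + 1) ∧ j < i ∧
      (f i = j ∨ f j = i) := by
  simp only [lowerCorners, Finset.mem_filter, Finset.mem_product, Finset.mem_range,
    and_iff_right_iff_imp]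
  intro h
  have := h.1.le
  omega

theorem lowerCorners_nil (f : ℕ → ℕ) : lowerCorners [] f = ∅ := by
  ext ⟨i, j⟩
  simp only [mem_lowerCorners, Cell]
  simp
  omega

theorem lowerCorners_false {w : List Bool} {f : ℕ → ℕ} (hf : IsFilling w f) :
    lowerCorners (false :: w) f =
      insert (w.length + 1, 0) ((lowerCorners w f).erase (w.length, 0)) := by
  ext ⟨i, j⟩
  simp only [Finset.mem_insert, Finset.mem_erase, mem_lowerCorners, ne_eq, Prod.mk.injEq]
  constructor
  · rintro ⟨h, hd, hr, hlt, ho⟩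
    by_cases hij : i = w.length + 1 ∧ j = 0
    · exact Or.inl hij
    refine Or.inr ⟨?_, ?_, fun h' => hd (Or.inl h'), fun h' => hr (Or.inl h'), hlt, ho⟩
    · rintro ⟨rfl, rfl⟩
      exact hd (cell_zero_right.2 (by simp))
    · rcases h with h | h | h
      · exact h
      · exact absurd h hij
      · omega
  · rintro (⟨rfl, rfl⟩ | ⟨hij, h, hd, hr, hlt, ho⟩)
    · refine ⟨cell_zero_right.2 (by simp), fun h => ?_, not_cell_false_one w, by omega,
        Or.inl (hf.eq_zero _ (by omega))⟩
      have := h.le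
      simp at this
    · refine ⟨Or.inl h, ?_, ?_, hlt, ho⟩
      · rintro (h | h | h)
        · exact hd h
        · omega
        · omega
      · rintro (h | h | h)
        · exact hr h
        · omega
        · omega

theorem notMem_lowerCorners_true (w : List Bool) (f : ℕ → ℕ) (i : ℕ) :
    (i, 0) ∉ lowerCorners (true :: w) f := by
  rw [mem_lowerCorners]
  rintro ⟨h, hd, hr, -⟩
  rw [cell_zero_right] at h hd
  simp only [List.length_cons] at h hd
  obtain rfl : i = w.length + 1 := by omega
  exact hr (cell_true_one w)

theorem card_lowerCorners_false_true {w : List Bool} {f : ℕ → ℕ} (hf : IsFilling (true :: w) f) :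
    (lowerCorners (false :: true :: w) f).card = (lowerCorners (true :: w) f).card + 1 := by
  rw [lowerCorners_false hf, Finset.erase_eq_of_notMem (notMem_lowerCorners_true _ _ _),
    Finset.card_insert_of_notMem]
  exact notMem_lowerCorners_true _ _ _

theorem mem_lowerCorners_false {w : List Bool} {f : ℕ → ℕ} (hf : IsFilling w f) {i : ℕ} :
    (i, 0) ∈ lowerCorners (false :: w) f ↔ i = w.length + 1 := by
  rw [lowerCorners_false hf, Finset.mem_insert, Finset.mem_erase, mem_lowerCorners]
  simp only [Prod.mk.injEq, and_true, cell_zero_right, ne_eq]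
  omega

theorem card_lowerCorners_false_false {w : List Bool} {f : ℕ → ℕ} (hf : IsFilling w f) :
    (lowerCorners (false :: false :: w) f).card = (lowerCorners (false :: w) f).card := by
  have hf' : IsFilling (false :: w) f := by rwa [← mem_fillings, fillings_false, mem_fillings]
  have hmem := (mem_lowerCorners_false hf).2 rfl
  rw [lowerCorners_false hf', Finset.card_insert_of_notMem, List.length_cons,
    Finset.card_erase_add_one hmem]
  simp [mem_lowerCorners_false hf]

open scoped Classical in
theorem lowerCorners_true {w : List Bool} {f : ℕ → ℕ} (hf : IsFilling (true :: w) f) :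
    lowerCorners (true :: w) f = {p ∈ lowerCorners w (merge f) |
      p.2 = 0 → f (p.1 + 1) = 1 ∨ f 1 = p.1 + 1}.image fun p => (p.1 + 1, p.2 + 1) := by
  have hocc : ∀ i j, j < i → ((f (i + 1) = j + 1 ∨ f (j + 1) = i + 1) ↔
      (merge f i = j ∨ merge f j = i) ∧ (j = 0 → f (i + 1) = 1 ∨ f 1 = i + 1)) := by
    intro i j hij
    have h1 := hf.lt 1 one_ne_zero
    rcases j with _ | j
    · have : f 1 = i + 1 → f (i + 1) = 0 := fun h => by rw [h] at h1; omega
      simp only [merge, if_neg (show i ≠ 0 by omega), if_true, zero_add, true_imp_iff]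
      omega
    · simp only [merge, if_neg (show i ≠ 0 by omega), Nat.succ_ne_zero, if_false,
        false_imp_iff, and_true]
      omega
  ext ⟨i, j⟩
  simp only [Finset.mem_image, Finset.mem_filter, Prod.exists, Prod.mk.injEq, mem_lowerCorners]
  constructor
  · intro h
    rcases j with _ | j
    · exact absurd (mem_lowerCorners.2 h) (notMem_lowerCorners_true _ _ _)
    rcases i with _ | i
    · omega
    obtain ⟨h, hd, hr, hlt, ho⟩ := h
    rw [cell_true_succ] at h hd hr
    have := (hocc i j (by omega)).1 ho
    exact ⟨i, j, ⟨⟨h, hd, hr, by omega, this.1⟩, this.2⟩, rfl, rfl⟩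
  · rintro ⟨i, j, ⟨⟨h, hd, hr, hlt, ho⟩, h0⟩, rfl, rfl⟩
    rw [cell_true_succ, cell_true_succ, cell_true_succ]
    exact ⟨h, hd, hr, by omega, (hocc i j hlt).2 ⟨ho, h0⟩⟩

theorem card_image_succ_succ (s : Finset (ℕ × ℕ)) :
    (s.image fun p => (p.1 + 1, p.2 + 1)).card = s.card := by
  refine Finset.card_image_of_injective _ ?_
  rintro ⟨i, j⟩ ⟨i', j'⟩ h
  simpa using h

theorem card_lowerCorners_true_true {w : List Bool} {f : ℕ → ℕ}
    (hf : IsFilling (true :: true :: w) f) :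
    (lowerCorners (true :: true :: w) f).card = (lowerCorners (true :: w) (merge f)).card := by
  classical
  rw [lowerCorners_true hf, card_image_succ_succ, Finset.filter_true_of_mem]
  rintro ⟨i, j⟩ hp (rfl : j = 0)
  exact absurd hp (notMem_lowerCorners_true _ _ _)

theorem card_lowerCorners_true_false {w : List Bool} {f : ℕ → ℕ}
    (hf : IsFilling (true :: false :: w) f) :
    ((lowerCorners (true :: false :: w) f).card : ℤ) =
      (lowerCorners (false :: w) (merge f)).card -
        if f (w.length + 2) ≠ 1 ∧ f 1 ≠ w.length + 2 then 1 else 0 := by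
  classical
  have hg : IsFilling w (merge f) := by
    rw [← mem_fillings, ← fillings_false, mem_fillings]
    exact isFilling_merge hf
  rw [lowerCorners_true hf, card_image_succ_succ]
  split_ifs with h
  · rw [eq_sub_iff_add_eq, ← Finset.card_erase_add_one ((mem_lowerCorners_false hg).2 rfl),
      Nat.cast_add_one]
    congr 3
    ext ⟨i, j⟩
    simp only [Finset.mem_filter, Finset.mem_erase, ne_eq, Prod.mk.injEq, and_comm (b := _ ∈ _),
      and_congr_right_iff]
    intro hp
    constructor
    · rintro hj ⟨rfl, rfl⟩
      exact not_or.2 h (hj rfl)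
    · rintro hne rfl
      exact absurd ⟨(mem_lowerCorners_false hg).1 hp, rfl⟩ hne
  · rw [Finset.filter_true_of_mem, sub_zero]
    rintro ⟨i, j⟩ hp (rfl : j = 0)
    obtain rfl := (mem_lowerCorners_false hg).1 hp
    simp only
    tauto

theorem cell_false_true (w : List Bool) (i j : ℕ) :
    Cell (false :: true :: w) i j ↔ Cell (true :: false :: w) i j ∧
      ¬ (i = w.length + 2 ∧ j = 1) ∧ ¬ (i = 1 ∧ j = w.length + 2) := by
  rcases i with _ | i
  · simp only [cell_zero_left, List.length_cons]
    omega
  rcases j with _ | j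
  · simp only [cell_zero_right, List.length_cons]
    omega
  have hcell : Cell (false :: true :: w) (i + 1) (j + 1) ↔ Cell w i j := by
    rw [Cell, cell_true_succ]
    simp
  rw [hcell, cell_true_succ, Cell]
  by_cases h : Cell w i j
  · have := h.le
    simp only [h, true_or, true_iff, true_and]
    omega
  · simp only [h, false_or, false_iff]
    omega

theorem fillings_false_true (w : List Bool) :
    fillings (false :: true :: w) =
      {f ∈ fillings (true :: false :: w) | f (w.length + 2) ≠ 1 ∧ f 1 ≠ w.length + 2} := by
  ext f
  rw [Finset.mem_filter, mem_fillings, mem_fillings]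
  constructor
  · intro hf
    refine ⟨⟨hf.zero, hf.eq_zero, hf.lt, fun i hi => ((cell_false_true w _ _).1 (hf.cell i hi)).1⟩,
      fun h => ?_, fun h => ?_⟩
    · exact ((cell_false_true w _ _).1 (hf.cell (w.length + 2) le_rfl)).2.1 ⟨rfl, h⟩
    · exact ((cell_false_true w _ _).1 (hf.cell 1 (by simp))).2.2 ⟨rfl, h⟩
  · rintro ⟨hf, h₁, h₂⟩
    refine ⟨hf.zero, hf.eq_zero, hf.lt, fun i hi => (cell_false_true w _ _).2
      ⟨hf.cell i hi, ?_, ?_⟩⟩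
    · rintro ⟨rfl, h⟩
      exact h₁ h
    · rintro ⟨rfl, h⟩
      exact h₂ h

/-- The generating function of the fillings of the diagram of `w`. -/
noncomputable def weight (w : List Bool) (x : ℤ) : ℤ :=
  ∑ f ∈ fillings w, x ^ (zeros w.length f).card

/-- The generating function of the fillings of the diagram of `w`, counted with the number of
occupied corners below the diagonal. -/
noncomputable def cornerWeight (w : List Bool) (x : ℤ) : ℤ :=
  ∑ f ∈ fillings w, ((lowerCorners w f).card : ℤ) * x ^ (zeros w.length f).card

theorem pow_card_zeros_false {w : List Bool} {f : ℕ → ℕ} (hf : f ∈ fillings w) (x : ℤ) :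
    x ^ (zeros (false :: w).length f).card = x * x ^ (zeros w.length f).card := by
  rw [List.length_cons, card_zeros_succ ((mem_fillings.1 hf).eq_zero _ (by omega)), pow_succ']

theorem weight_nil (x : ℤ) : weight [] x = 1 := by
  have : fillings [] = {fun _ => 0} := by
    ext f
    rw [mem_fillings, Finset.mem_singleton]
    constructor
    · intro hf
      ext i
      simpa using hf.le i
    · rintro rfl
      exact ⟨rfl, fun _ _ => rfl, fun i hi => by omega, fun i hi => cell_zero_right.2 hi⟩
  simp [weight, this, zeros]

theorem weight_false (w : List Bool) (x : ℤ) : weight (false :: w) x = x * weight w x := by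
  rw [weight, weight, fillings_false, Finset.mul_sum]
  exact Finset.sum_congr rfl fun f hf => pow_card_zeros_false hf x

theorem weight_true (w : List Bool) (x : ℤ) :
    weight (true :: w) x = 2 * x * weight w (x + 1) - x * weight w x := by
  simpa only [weight, one_mul, List.length_cons] using sum_fillings_true w (fun _ => 1) x

theorem cornerWeight_singleton_false (x : ℤ) : cornerWeight [false] x = x := by
  have h : weight [false] x = x := by rw [weight_false, weight_nil, mul_one]
  conv_rhs => rw [← h]
  refine Finset.sum_congr (by rw [fillings_false]) fun f hf => ?_
  rw [fillings_false, mem_fillings] at hf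
  simp [lowerCorners_false hf, lowerCorners_nil]

theorem cornerWeight_singleton_true (x : ℤ) : cornerWeight [true] x = 0 := by
  classical
  refine Finset.sum_eq_zero fun f hf => ?_
  simp [lowerCorners_true (mem_fillings.1 hf), lowerCorners_nil]

theorem cornerWeight_false_false (w : List Bool) (x : ℤ) :
    cornerWeight (false :: false :: w) x = x * cornerWeight (false :: w) x := by
  rw [cornerWeight, cornerWeight, fillings_false (false :: w), Finset.mul_sum]
  refine Finset.sum_congr rfl fun f hf => ?_
  rw [pow_card_zeros_false hf, card_lowerCorners_false_false]
  · ring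
  · rwa [fillings_false, mem_fillings] at hf

theorem cornerWeight_false_true (w : List Bool) (x : ℤ) :
    cornerWeight (false :: true :: w) x =
      x * cornerWeight (true :: w) x + x * weight (true :: w) x := by
  rw [cornerWeight, cornerWeight, weight, fillings_false, Finset.mul_sum, Finset.mul_sum,
    ← Finset.sum_add_distrib]
  refine Finset.sum_congr rfl fun f hf => ?_
  rw [pow_card_zeros_false hf, card_lowerCorners_false_true (mem_fillings.1 hf)]
  push_cast
  ring

theorem cornerWeight_true_true (w : List Bool) (x : ℤ) :
    cornerWeight (true :: true :: w) x =
      2 * x * cornerWeight (true :: w) (x + 1) - x * cornerWeight (true :: w) x := by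
  rw [cornerWeight, cornerWeight, cornerWeight,
    ← sum_fillings_true (true :: w) (fun g => ((lowerCorners (true :: w) g).card : ℤ)) x]
  refine Finset.sum_congr rfl fun f hf => ?_
  rw [card_lowerCorners_true_true (mem_fillings.1 hf), List.length_cons]

theorem cornerWeight_true_false (w : List Bool) (x : ℤ) :
    cornerWeight (true :: false :: w) x =
      2 * x * cornerWeight (false :: w) (x + 1) - x * cornerWeight (false :: w) x -
        x * weight (true :: w) x := by
  rw [← weight_false, cornerWeight, cornerWeight, cornerWeight, weight,
    ← sum_fillings_true (false :: w) (fun g => ((lowerCorners (false :: w) g).card : ℤ)) x,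
    fillings_false_true, Finset.sum_filter, ← Finset.sum_sub_distrib]
  refine Finset.sum_congr rfl fun f hf => ?_
  rw [card_lowerCorners_true_false (mem_fillings.1 hf), sub_mul, ite_mul, one_mul, zero_mul]
  rfl

theorem sum_weight_succ (n : ℕ) (x : ℤ) :
    ∑ w ∈ words (n + 1), weight w x = 2 * x * ∑ w ∈ words n, weight w (x + 1) := by
  rw [sum_words_succ, Finset.mul_sum]
  refine Finset.sum_congr rfl fun w _ => ?_
  rw [weight_false, weight_true]
  ring

theorem sum_weight (n : ℕ) (x : ℤ) :
    ∑ w ∈ words n, weight w x = 2 ^ n * ∏ i ∈ Finset.range n, (x + i) := by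
  induction n generalizing x with
  | zero => simp [words, weight_nil]
  | succ n ih =>
    rw [sum_weight_succ, ih, Finset.prod_range_succ']
    push_cast
    simp only [add_assoc, add_comm (1 : ℤ)]
    ring

theorem sum_cornerWeight (n : ℕ) (x : ℤ) :
    2 * ∑ w ∈ words (n + 1), cornerWeight w x = ∑ w ∈ words (n + 1), weight w x := by
  induction n generalizing x with
  | zero =>
    rw [sum_weight_succ, sum_words_succ]
    simp [words, weight_nil, cornerWeight_singleton_false, cornerWeight_singleton_true]
  | succ n ih =>
    rw [sum_weight_succ, ← ih, sum_words_succ, sum_words_succ, sum_words_succ]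
    simp only [Finset.mul_sum]
    refine Finset.sum_congr rfl fun w _ => ?_
    rw [cornerWeight_false_false, cornerWeight_false_true, cornerWeight_true_true,
      cornerWeight_true_false]
    ring

theorem sum_cornerWeight_one (n : ℕ) :
    2 * ∑ w ∈ words (n + 1), cornerWeight w 1 = 2 ^ (n + 1) * (n + 1).factorial := by
  rw [sum_cornerWeight, sum_weight, ← Finset.prod_range_add_one_eq_factorial]
  push_cast
  simp only [add_comm]

/-- The points of the tableau coded by a filling of a diagram with `n + 1` rows. -/
def pointSet (n : ℕ) (f : ℕ → ℕ) : Finset (ℕ × ℕ) :=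
  (Finset.range (n + 1)).image (fun i => (i, f i)) ∪ (Finset.Icc 1 n).image (fun i => (f i, i))

theorem mem_pointSet {w : List Bool} {f : ℕ → ℕ} (hf : IsFilling w f) {i j : ℕ} :
    (i, j) ∈ pointSet w.length f ↔ (i ≤ w.length ∧ j ≤ w.length) ∧ (f i = j ∨ f j = i) := by
  simp only [pointSet, Finset.mem_union, Finset.mem_image, Finset.mem_range, Finset.mem_Icc,
    Prod.mk.injEq]
  constructor
  · rintro (⟨k, hk, rfl, rfl⟩ | ⟨k, hk, rfl, rfl⟩)
    · exact ⟨⟨by omega, hf.le k⟩, Or.inl rfl⟩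
    · exact ⟨⟨hf.le k, hk.2⟩, Or.inr rfl⟩
  · rintro ⟨⟨hi, hj⟩, rfl | rfl⟩
    · exact Or.inl ⟨i, by omega, rfl, rfl⟩
    · rcases Nat.eq_zero_or_pos j with rfl | hj'
      · exact Or.inl ⟨0, by omega, hf.zero.symm, hf.zero⟩
      · exact Or.inr ⟨j, ⟨hj', hj⟩, rfl, rfl⟩

theorem card_pointSet {w : List Bool} {f : ℕ → ℕ} (hf : IsFilling w f) :
    (pointSet w.length f).card = 2 * w.length + 1 := by
  rw [pointSet, Finset.card_union_of_disjoint, Finset.card_image_of_injective,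
    Finset.card_image_of_injective]
  · simp
    omega
  · exact fun i j h => congrArg Prod.snd h
  · exact fun i j h => congrArg Prod.fst h
  · simp only [Finset.disjoint_left, Finset.mem_image, Finset.mem_Icc, not_exists, not_and]
    rintro _ ⟨i, -, rfl⟩ j hj h
    rw [Prod.mk.injEq] at h
    have := hf.lt j (by omega)
    rw [h.1, ← h.2] at this
    exact lt_irrefl _ this

theorem IsFilling.le_of_apply_eq {w : List Bool} {f : ℕ → ℕ} (hf : IsFilling w f) {i c : ℕ}
    (hi : i ≠ 0) (hc : f c = i) : f i ≤ c := by
  subst hc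
  rcases Nat.eq_zero_or_pos c with rfl | hc
  · exact absurd hf.zero hi
  · exact (hf.lt c hc.ne').le

theorem mem_pointSet_comm {w : List Bool} {f : ℕ → ℕ} (hf : IsFilling w f) {i j : ℕ} :
    (i, j) ∈ pointSet w.length f ↔ (j, i) ∈ pointSet w.length f := by
  rw [mem_pointSet hf, mem_pointSet hf]
  tauto

theorem apply_le_of_mem_pointSet {w : List Bool} {f : ℕ → ℕ} (hf : IsFilling w f) {i c : ℕ}
    (h : (i, c) ∈ pointSet w.length f) : f i ≤ c := by
  rcases Nat.eq_zero_or_pos i with rfl | hi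
  · simp [hf.zero]
  rcases ((mem_pointSet hf).1 h).2 with h | h
  · exact h.le
  · exact hf.le_of_apply_eq hi.ne' h

theorem apply_mem_pointSet {w : List Bool} {f : ℕ → ℕ} (hf : IsFilling w f) {i : ℕ}
    (hi : i ≤ w.length) : (i, f i) ∈ pointSet w.length f :=
  (mem_pointSet hf).2 ⟨⟨hi, hf.le i⟩, Or.inl rfl⟩

theorem cell_of_mem_pointSet {w : List Bool} {f : ℕ → ℕ} (hf : IsFilling w f) {i j : ℕ}
    (h : (i, j) ∈ pointSet w.length f) : Cell w i j := by
  obtain ⟨⟨hi, hj⟩, rfl | rfl⟩ := (mem_pointSet hf).1 h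
  · exact hf.cell i hi
  · exact (hf.cell j hj).symm

theorem exists_above {w : List Bool} {f : ℕ → ℕ} (hf : IsFilling w f) {i : ℕ} (hi : i ≠ 0) :
    ∃ r < i, (r, f i) ∈ pointSet w.length f :=
  ⟨f (f i), hf.lt i hi, (mem_pointSet_comm hf).1 (apply_mem_pointSet hf (hf.le i))⟩

open scoped Classical in
/-- The Young diagram coded by a word. -/
noncomputable def diagram (w : List Bool) : YoungDiagram where
  cells := {p ∈ Finset.range (w.length + 1) ×ˢ Finset.range (w.length + 1) | Cell w p.1 p.2}
  isLowerSet := by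
    rintro ⟨i, j⟩ ⟨i', j'⟩ ⟨hi, hj⟩ h
    simp only [Finset.coe_filter, Finset.mem_product, Finset.mem_range, Set.mem_ofPred_eq] at h ⊢
    exact ⟨⟨lt_of_le_of_lt hi h.1.1, lt_of_le_of_lt hj h.1.2⟩, h.2.mono hi hj⟩

theorem mem_cells_diagram {w : List Bool} {i j : ℕ} :
    (i, j) ∈ (diagram w).cells ↔ Cell w i j := by
  simp only [diagram, Finset.mem_filter, Finset.mem_product, Finset.mem_range,
    and_iff_right_iff_imp]
  intro h
  have := h.le
  omega

/-- The symmetric tree-like tableau coded by a word and a filling. -/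
noncomputable def toTableau {w : List Bool} {f : ℕ → ℕ} (hf : IsFilling w f) :
    TreeLikeTableau where
  shape := diagram w
  points := pointSet w.length f
  points_subset := by
    rintro ⟨i, j⟩ h
    exact mem_cells_diagram.2 (cell_of_mem_pointSet hf h)
  root_mem := (mem_pointSet hf).2 ⟨⟨Nat.zero_le _, Nat.zero_le _⟩, Or.inl hf.zero⟩
  point_cond := by
    have hleft : ∀ i, ¬ ∃ c < f i, (i, c) ∈ pointSet w.length f := by
      rintro i ⟨c, hc, h⟩
      exact absurd (apply_le_of_mem_pointSet hf h) (not_le.2 hc)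
    rintro ⟨i, j⟩ h hne
    simp only
    obtain ⟨⟨hi, hj⟩, rfl | rfl⟩ := (mem_pointSet hf).1 h
    · refine Or.inl ⟨exists_above hf ?_, hleft i⟩
      rintro rfl
      exact hne (by rw [hf.zero])
    · refine Or.inr ⟨?_, ?_⟩
      · simp_rw [mem_pointSet_comm hf]
        refine exists_above hf ?_
        rintro rfl
        exact hne (by rw [hf.zero])
      · simp_rw [mem_pointSet_comm hf (j := j)]
        exact hleft j
  no_empty_row i j h := ⟨f i, apply_mem_pointSet hf (mem_cells_diagram.1 h).le.1⟩
  no_empty_col i j h :=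
    ⟨f j, (mem_pointSet_comm hf).1 (apply_mem_pointSet hf (mem_cells_diagram.1 h).le.2)⟩

theorem isSymmetric_toTableau {w : List Bool} {f : ℕ → ℕ} (hf : IsFilling w f) :
    (toTableau hf).IsSymmetric := by
  refine ⟨?_, fun p => mem_pointSet_comm hf⟩
  ext ⟨i, j⟩
  rw [YoungDiagram.mem_cells, YoungDiagram.mem_transpose, ← YoungDiagram.mem_cells]
  exact mem_cells_diagram.trans (Iff.trans ⟨Cell.symm, Cell.symm⟩ mem_cells_diagram.symm)

/-- The column of the leftmost point of the row `i`. -/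
noncomputable def leftmost (P : Finset (ℕ × ℕ)) (i : ℕ) : ℕ := sInf {c | (i, c) ∈ P}

theorem leftmost_pointSet {w : List Bool} {f : ℕ → ℕ} (hf : IsFilling w f) :
    leftmost (pointSet w.length f) = f := by
  ext i
  by_cases hi : i ≤ w.length
  · exact le_antisymm (Nat.sInf_le (apply_mem_pointSet hf hi))
      (le_csInf ⟨_, apply_mem_pointSet hf hi⟩ fun c hc => apply_le_of_mem_pointSet hf hc)
  · have : {c | (i, c) ∈ pointSet w.length f} = ∅ := by
      ext c
      simp only [mem_pointSet hf, Set.mem_ofPred_eq, Set.mem_empty_iff_false]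
      tauto
    rw [leftmost, this, Nat.sInf_empty, hf.eq_zero i (by omega)]

theorem eq_of_shape_of_points {T T' : TreeLikeTableau} (h : T.shape = T'.shape)
    (h' : T.points = T'.points) : T = T' := by
  cases T
  cases T'
  simp only at h h'
  subst h h'
  rfl

theorem exists_toTableau {T : TreeLikeTableau} (hT : T.IsSymmetric) :
    ∃ (w : List Bool) (f : ℕ → ℕ) (hf : IsFilling w f), toTableau hf = T := by
  obtain ⟨hshape, hpts⟩ := hT
  have hcol : ∀ i, (i, 0) ∈ T.shape ↔ i < T.shape.colLen 0 := fun i =>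
    YoungDiagram.mem_iff_lt_colLen
  have hpos := (hcol 0).1 (T.points_subset T.root_mem)
  obtain ⟨w, -, hw⟩ := exists_word (T.shape.colLen 0 - 1) (fun i j => (i, j) ∈ T.shape)
    (fun i j h => by rwa [← hshape, YoungDiagram.mem_transpose])
    (fun i j i' j' h hi hj => T.shape.up_left_mem hi hj h)
    ((hcol _).2 (by omega)) (by rw [hcol]; omega)
  have hmem : ∀ {i}, i ≤ w.length → (i, leftmost T.points i) ∈ T.points := fun {i} hi =>
    Nat.sInf_mem (T.no_empty_row i 0 ((hw i 0).1 (cell_zero_right.2 hi)))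
  have hle : ∀ {i c}, (i, c) ∈ T.points → leftmost T.points i ≤ c := fun h => Nat.sInf_le h
  have hout : ∀ {i}, w.length < i → leftmost T.points i = 0 := by
    intro i hi
    have : {c | (i, c) ∈ T.points} = ∅ := by
      ext c
      simp only [Set.mem_ofPred_eq, Set.mem_empty_iff_false, iff_false]
      intro h
      have := ((hw i c).2 (T.points_subset h)).le
      omega
    rw [leftmost, this, Nat.sInf_empty]
  have hzero : leftmost T.points 0 = 0 := Nat.le_zero.1 (hle T.root_mem)
  have hf : IsFilling w (leftmost T.points) := by
    refine ⟨hzero, fun i hi => hout hi, fun i hi => ?_, fun i hi => ?_⟩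
    · by_cases hiw : i ≤ w.length
      · rcases T.point_cond _ (hmem hiw) (by simp [hi]) with ⟨⟨r, hr, h⟩, -⟩ | ⟨⟨c, hc, h⟩, -⟩
        · exact lt_of_le_of_lt (hle ((hpts _).1 h)) hr
        · exact absurd (hle h) (not_le.2 hc)
      · rw [hout (not_le.1 hiw), hzero]
        exact Nat.pos_of_ne_zero hi
    · exact (hw _ _).2 (T.points_subset (hmem hi))
  refine ⟨w, _, hf, eq_of_shape_of_points ?_ ?_⟩
  · ext ⟨i, j⟩
    exact mem_cells_diagram.trans (hw i j)
  · ext ⟨i, j⟩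
    refine (mem_pointSet hf).trans ⟨?_, fun h => ?_⟩
    · rintro ⟨⟨hi, hj⟩, rfl | rfl⟩
      · exact hmem hi
      · exact (hpts _).1 (hmem hj)
    · refine ⟨((hw _ _).2 (T.points_subset h)).le, ?_⟩
      by_cases hij : (i, j) = (0, 0)
      · obtain ⟨rfl, rfl⟩ := Prod.mk.inj hij
        exact Or.inl hzero
      by_contra! hne
      have h' := (hpts _).1 h
      have h₁ := lt_of_le_of_ne (hle h) hne.1
      have h₂ := lt_of_le_of_ne (hle h') hne.2
      have hC := ((hw _ _).2 (T.points_subset h)).le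
      have hleft : ∃ c < j, (i, c) ∈ T.points := ⟨_, h₁, hmem hC.1⟩
      have habove : ∃ r < i, (r, j) ∈ T.points := ⟨_, h₂, (hpts _).1 (hmem hC.2)⟩
      rcases T.point_cond _ h hij with h | h
      · exact h.2 hleft
      · exact h.2 habove

theorem toTableau_inj {w w' : List Bool} {f f' : ℕ → ℕ} {hf : IsFilling w f}
    {hf' : IsFilling w' f'} (h : toTableau hf = toTableau hf') : w = w' ∧ f = f' := by
  obtain rfl : w = w' := cell_injective fun i j => by
    rw [← mem_cells_diagram, ← mem_cells_diagram]
    exact (congrArg (fun T : TreeLikeTableau => (i, j) ∈ T.shape.cells) h).to_iff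
  refine ⟨rfl, ?_⟩
  rw [← leftmost_pointSet hf, ← leftmost_pointSet hf']
  exact congrArg (fun T : TreeLikeTableau => leftmost T.points) h

theorem sum_eq_sum_fillings {n : ℕ} {S : Finset TreeLikeTableau}
    (hS : ∀ T, T ∈ S ↔ T.size = 2 * n + 1 ∧ T.IsSymmetric) (F : TreeLikeTableau → ℤ)
    (φ : List Bool → (ℕ → ℕ) → ℤ)
    (hφ : ∀ w f, w.length = n → ∀ hf : IsFilling w f, F (toTableau hf) = φ w f) :
    ∑ T ∈ S, F T = ∑ w ∈ words n, ∑ f ∈ fillings w, φ w f := by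
  rw [Finset.sum_sigma']
  have hmem : ∀ a : (_ : List Bool) × (ℕ → ℕ), a ∈ (words n).sigma (fun w => fillings w) →
      a.1.length = n ∧ IsFilling a.1 a.2 := fun a ha => by
    rwa [Finset.mem_sigma, mem_words, mem_fillings] at ha
  symm
  refine Finset.sum_bij (fun a ha => toTableau (hmem a ha).2) ?_ ?_ ?_ ?_
  · intro a ha
    refine (hS _).2 ⟨?_, isSymmetric_toTableau _⟩
    exact (card_pointSet (hmem a ha).2).trans (by rw [(hmem a ha).1])
  · rintro ⟨w, f⟩ _ ⟨w', f'⟩ _ h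
    obtain ⟨rfl, rfl⟩ := toTableau_inj h
    rfl
  · intro T hT
    rw [hS] at hT
    obtain ⟨w, f, hf, rfl⟩ := exists_toTableau hT.2
    have hlen := (card_pointSet hf).symm.trans hT.1
    have hw : w.length = n := by omega
    exact ⟨⟨w, f⟩, Finset.mem_sigma.2 ⟨mem_words.2 hw, mem_fillings.2 hf⟩, rfl⟩
  · intro a ha
    exact (hφ _ _ (hmem a ha).1 _).symm

theorem mem_occCorners_toTableau {w : List Bool} {f : ℕ → ℕ} (hf : IsFilling w f) {i j : ℕ} :
    (i, j) ∈ (toTableau hf).occCorners ↔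
      (i, j) ∈ pointSet w.length f ∧ ¬ Cell w (i + 1) j ∧ ¬ Cell w i (j + 1) := by
  rw [TreeLikeTableau.occCorners, Finset.mem_filter]
  exact and_congr_right' (and_congr (not_congr mem_cells_diagram) (not_congr mem_cells_diagram))

theorem oc_toTableau_nil {f : ℕ → ℕ} (hf : IsFilling [] f) : (toTableau hf).oc = 1 := by
  rw [TreeLikeTableau.oc, Finset.card_eq_one]
  refine ⟨(0, 0), ?_⟩
  ext ⟨i, j⟩
  rw [mem_occCorners_toTableau, Finset.mem_singleton, mem_pointSet hf]
  simp only [Cell, List.length_nil, Prod.mk.injEq]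
  constructor
  · omega
  · rintro ⟨rfl, rfl⟩
    simp [hf.zero]

theorem oc_toTableau {w : List Bool} {f : ℕ → ℕ} (hw : w.length ≠ 0) (hf : IsFilling w f) :
    (toTableau hf).oc = 2 * (lowerCorners w f).card := by
  have hswap : ((lowerCorners w f).image Prod.swap).card = (lowerCorners w f).card :=
    Finset.card_image_of_injective _ Prod.swap_injective
  have hmem : ∀ i j, (i, j) ∈ (lowerCorners w f).image Prod.swap ↔ (j, i) ∈ lowerCorners w f := by
    intro i j
    rw [Finset.mem_image]
    exact ⟨by rintro ⟨⟨a, b⟩, h, h'⟩; cases h'; exact h, fun h => ⟨_, h, rfl⟩⟩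
  have hsymm : ∀ i j, Cell w i j ↔ Cell w j i := fun i j => ⟨Cell.symm, Cell.symm⟩
  rw [TreeLikeTableau.oc, two_mul]
  nth_rewrite 2 [← hswap]
  rw [← Finset.card_union_of_disjoint]
  · congr 1
    ext ⟨i, j⟩
    rw [mem_occCorners_toTableau, Finset.mem_union, hmem, mem_lowerCorners, mem_lowerCorners,
      hsymm j i, hsymm (j + 1) i, hsymm j (i + 1)]
    constructor
    · rintro ⟨h, hd, hr⟩
      have hc := cell_of_mem_pointSet hf h
      have ho := ((mem_pointSet hf).1 h).2
      rcases lt_trichotomy i j with hij | rfl | hij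
      · exact Or.inr ⟨hc, hr, hd, hij, ho.symm⟩
      · have hfi : f i = i := by tauto
        rcases Nat.eq_zero_or_pos i with rfl | hi
        · exact absurd (cell_zero_right.2 (by omega)) hd
        · have := hf.lt i hi.ne'
          rw [hfi, hfi] at this
          exact absurd this (lt_irrefl _)
      · exact Or.inl ⟨hc, hd, hr, hij, ho⟩
    · rintro (⟨hc, hd, hr, -, ho⟩ | ⟨hc, hr, hd, -, ho⟩)
      · exact ⟨(mem_pointSet hf).2 ⟨hc.le, ho⟩, hd, hr⟩
      · exact ⟨(mem_pointSet hf).2 ⟨hc.le, ho.symm⟩, hd, hr⟩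
  · rw [Finset.disjoint_left]
    rintro ⟨i, j⟩ h h'
    rw [hmem] at h'
    have h₁ := (mem_lowerCorners.1 h).2.2.2.1
    have h₂ := (mem_lowerCorners.1 h').2.2.2.1
    omega

end SymmetricTableau

/-- The total number of occupied corners over all symmetric tree-like tableaux
of size `2n+1` equals `2^n · n!`. -/
theorem total_occupied_corners_symmetric (n : ℕ)
    (S : Finset TreeLikeTableau)
    (hS : ∀ T, T ∈ S ↔ T.size = 2 * n + 1 ∧ T.IsSymmetric) :
    ∑ T ∈ S, T.oc = 2 ^ n * n.factorial := by
  open SymmetricTableau in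
  rw [← Nat.cast_inj (R := ℤ), Nat.cast_sum]
  push_cast
  rcases n with _ | n
  · rw [sum_eq_sum_fillings hS _ (fun _ f => 1 ^ (zeros 0 f).card)]
    · have h := sum_weight 0 1
      simpa [words, weight] using h
    · intro w f hw hf
      obtain rfl := List.length_eq_zero_iff.1 hw
      simp [oc_toTableau_nil]
  · rw [sum_eq_sum_fillings hS _ (fun w f => 2 * ((lowerCorners w f).card : ℤ)),
      ← sum_cornerWeight_one]
    · simp [cornerWeight, Finset.mul_sum]
    · intro w f hw hf
      rw [oc_toTableau (by omega)]
      push_cast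
      rfl
end
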